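/- Let n ≥ 2 be an integer, α > 0, p ∈ {1,…,n−1} coprime to n, and let g be a type (i) coupling satisfying the quantisation condition M ∈ ℤ ∖ {0}. Then for every r ∈ {1,…,n−1} and every μ ∈ Λ⁺_{p,|M|}, one has Σ_{ν∈S_n(ω_r), μ+ν∈Λ⁺_{p,|M|}} W_ν(ρ_p+sgn(M)μ) · √(Δ_p(μ+ν)) = ℰ_r(ρ(g)) · √(Δ_p(μ)), where ρ(g) = g·(ω_1+…+ω_{n−1}); that is, the lattice function Ψ_0 with values Ψ_0(ρ_p+sgn(M)μ) proportional to √(Δ_p(μ)) is a joint eigenfunction of the operators Ŝ_{r,M} with eigenvalues ℰ_r(ρ(g)). -/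

import Mathlib

noncomputable section
open Real Finset
open scoped Classical

/-- The standard basis vector `e_j` of `ℝⁿ` (1-based index), extended `n`-periodically
(`e_{n+j} = e_j`). -/
def ee (n j : ℕ) : Fin n → ℝ := fun i => if ((i : ℕ) + 1) % n = j % n then 1 else 0

/-- The standard inner product on `ℝⁿ`. -/
def inn {n : ℕ} (x y : Fin n → ℝ) : ℝ := ∑ i, x i * y i

/-- The coordinate `x_j` (1-based index) with the convention `x_{n+k} = x_k - 2π/α`. -/
def coord {n : ℕ} (α : ℝ) (x : Fin n → ℝ) (j : ℕ) : ℝ :=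
  if h : 0 < n then x ⟨(j - 1) % n, Nat.mod_lt _ h⟩ - 2 * π / α * (((j - 1) / n : ℕ) : ℝ)
  else 0

/-- The simple roots `a_{j,p} = e_j - e_{j+p}`. -/
def aa (n p j : ℕ) : Fin n → ℝ := ee n j - ee n (j + p)

/-- The closed simplex `Σ̄_{g,p} = {x ∈ E_n : sgn(M)(x_j - x_{j+p} - g) ≥ 0, j = 1,…,n}`,
where `M = 2πp/α - ng`. -/
def SigmaBar (n p : ℕ) (α g : ℝ) : Set (Fin n → ℝ) :=
  {x | (∑ i, x i) = 0 ∧ ∀ j ∈ Icc 1 n,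
    0 ≤ Real.sign (2 * π * p / α - n * g) * (coord α x j - coord α x (j + p) - g)}

/-- The interior `Σ_{g,p}` of the simplex, cut out by the strict inequalities. -/
def SigmaInt (n p : ℕ) (α g : ℝ) : Set (Fin n → ℝ) :=
  {x | (∑ i, x i) = 0 ∧ ∀ j ∈ Icc 1 n,
    0 < Real.sign (2 * π * p / α - n * g) * (coord α x j - coord α x (j + p) - g)}

/-- `g` is a type (i) coupling, with `q ∈ {1,…,n-1}` the multiplicative inverse of `p` mod `n`. -/
def TypeI (n p q : ℕ) (α g : ℝ) : Prop :=
  1 ≤ q ∧ q ≤ n - 1 ∧ (p * q) % n = 1 % n ∧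
  ((2 * π / α * ((p : ℝ) / n - 1 / ((n : ℝ) * q)) < g ∧ g < 2 * π / α * ((p : ℝ) / n)) ∨
   (2 * π / α * ((p : ℝ) / n) < g ∧
      g < 2 * π / α * ((p : ℝ) / n + 1 / ((n : ℝ) * ((n : ℝ) - q)))))

/-- `ρ_p = g(ω_{1,p}+…+ω_{n-p,p}) + (g - 2π/α)(ω_{n-p+1,p}+…+ω_{n-1,p})`. -/
def rhoP (n p : ℕ) (α g : ℝ) (ω : ℕ → Fin n → ℝ) : Fin n → ℝ :=
  g • (∑ j ∈ Icc 1 (n - p), ω j) + (g - 2 * π / α) • (∑ j ∈ Icc (n - p + 1) (n - 1), ω j)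

/-- `Λ⁺_{p,|M|}`: nonnegative integral combinations of the `ω_{j,p}` with coefficient sum `≤ |M|`. -/
def Lam (n : ℕ) (Mabs : ℝ) (ω : ℕ → Fin n → ℝ) : Set (Fin n → ℝ) :=
  {μ | ∃ m : ℕ → ℕ, (∑ j ∈ Icc 1 (n - 1), (m j : ℝ)) ≤ Mabs ∧
    μ = ∑ j ∈ Icc 1 (n - 1), (m j : ℝ) • ω j}

/-- The fundamental weight `ω_r = e_1+…+e_r - (r/n)(e_1+…+e_n)`. -/
def omegaStd (n r : ℕ) : Fin n → ℝ :=
  fun i => (if (i : ℕ) + 1 ≤ r then 1 else 0) - (r : ℝ) / n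

/-- Membership in the orbit `S_n(ω_r)` of `ω_r` under coordinate permutations. -/
def inOrbit (n r : ℕ) (ν : Fin n → ℝ) : Prop :=
  ∃ σ : Equiv.Perm (Fin n), ν = fun i => omegaStd n r (σ i)

/-- The orbit `S_n(ω_r)` as a finite set. -/
def orbitF (n r : ℕ) : Finset (Fin n → ℝ) :=
  Finset.image (fun σ : Equiv.Perm (Fin n) => fun i => omegaStd n r (σ i)) Finset.univ

/-- `V_ν(g;x) = ∏_{a ∈ A_{n-1}, ⟨a,ν⟩=1} sin(α(⟨a,x⟩+g)/2)/sin(α⟨a,x⟩/2)`. -/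
def Vnu (n : ℕ) (α g : ℝ) (ν x : Fin n → ℝ) : ℝ :=
  ∏ j ∈ Icc 1 n, ∏ k ∈ Icc 1 n,
    if j ≠ k ∧ inn (ee n j - ee n k) ν = 1 then
      Real.sin (α * (inn (ee n j - ee n k) x + g) / 2) /
        Real.sin (α * inn (ee n j - ee n k) x / 2)
    else 1

/-- `V_J(g;x) = ∏_{j∈J, k∉J} sin(α(x_j-x_k+g)/2)/sin(α(x_j-x_k)/2)`. -/
def VJ (n : ℕ) (α g : ℝ) (J : Finset ℕ) (x : Fin n → ℝ) : ℝ :=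
  ∏ j ∈ J, ∏ k ∈ Icc 1 n \ J,
    Real.sin (α * (coord α x j - coord α x k + g) / 2) /
      Real.sin (α * (coord α x j - coord α x k) / 2)

/-- `F_J(g;x) = ∏_{j,k∈J, j≠k} sin(α(x_j-x_k)/2)/sin(α(x_j-x_k+g)/2)`. -/
def FJ (n : ℕ) (α g : ℝ) (J : Finset ℕ) (x : Fin n → ℝ) : ℝ :=
  ∏ j ∈ J, ∏ k ∈ J,
    if j ≠ k then
      Real.sin (α * (coord α x j - coord α x k) / 2) /
        Real.sin (α * (coord α x j - coord α x k + g) / 2)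
    else 1

/-- The trigonometric Pochhammer symbol `(z : sin_α)_m`. -/
def poch (α z : ℝ) (m : ℤ) : ℝ :=
  if 0 ≤ m then ∏ l ∈ Finset.range m.toNat, Real.sin (α * (z + l) / 2)
  else 1 / ∏ l ∈ Finset.Icc 1 (-m).toNat, Real.sin (α * (z - l) / 2)

/-- Membership in the set of positive roots `A⁺_{n-1,p}`. -/
def inPosRoots (n p : ℕ) (v : Fin n → ℝ) : Prop :=
  (∃ j ∈ Icc 1 n, ∃ k ∈ Icc 1 n, j ≠ k ∧ v = ee n j - ee n k) ∧
  ∃ c : ℕ → ℕ, v = ∑ j ∈ Icc 1 (n - 1), (c j : ℝ) • aa n p j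

/-- The lattice function `Δ_p(μ)`. -/
def Delta (n p : ℕ) (α g : ℝ) (ω : ℕ → Fin n → ℝ) (μ : Fin n → ℝ) : ℝ :=
  ∏ j ∈ Icc 1 n, ∏ k ∈ Icc 1 n,
    if inPosRoots n p (ee n j - ee n k) then
      Real.sin (α * inn (ee n j - ee n k)
          (rhoP n p α g ω + Real.sign (2 * π * p / α - n * g) • μ) / 2) /
        Real.sin (α * inn (ee n j - ee n k) (rhoP n p α g ω) / 2) *
      (poch α (inn (ee n j - ee n k) (rhoP n p α g ω) +
            Real.sign (2 * π * p / α - n * g) * g)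
          ⌊Real.sign (2 * π * p / α - n * g) * inn (ee n j - ee n k) μ⌋ /
        poch α (inn (ee n j - ee n k) (rhoP n p α g ω) + 1 -
            Real.sign (2 * π * p / α - n * g) * g)
          ⌊Real.sign (2 * π * p / α - n * g) * inn (ee n j - ee n k) μ⌋)
    else 1

/-- The coefficient `W_ν(ρ_p + sgn(M)μ)` (equal to `0` when `μ + ν ∉ Λ⁺_{p,|M|}`). -/
def Wmu (n p : ℕ) (α g : ℝ) (ω : ℕ → Fin n → ℝ) (s : (Fin n → ℝ) → ℝ)
    (μ ν : Fin n → ℝ) : ℝ :=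
  if μ + ν ∈ Lam n |2 * π * p / α - n * g| ω then
    s ν * Real.sqrt
      (Vnu n α g ν (rhoP n p α g ω + Real.sign (2 * π * p / α - n * g) • μ) *
       Vnu n α g ν (-(rhoP n p α g ω) - Real.sign (2 * π * p / α - n * g) • (μ + ν)))
  else 0

/-- The discrete difference operator `Ŝ_{r,M}` acting on lattice functions. -/
def SOp (n p r : ℕ) (α g : ℝ) (ω : ℕ → Fin n → ℝ) (s : (Fin n → ℝ) → ℝ)
    (φ : (Fin n → ℝ) → ℂ) : (Fin n → ℝ) → ℂ :=
  fun x => ∑ ν ∈ orbitF n r,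
    (Wmu n p α g ω s (Real.sign (2 * π * p / α - n * g) • (x - rhoP n p α g ω)) ν : ℂ) *
      φ (x + Real.sign (2 * π * p / α - n * g) • ν)

/-- The inner product `(φ, ψ)_{p,M}` on lattice functions. -/
def ip (n p : ℕ) (α g : ℝ) (ω : ℕ → Fin n → ℝ) (φ ψ : (Fin n → ℝ) → ℂ) : ℂ :=
  ∑ᶠ μ ∈ Lam n |2 * π * p / α - n * g| ω,
    φ (rhoP n p α g ω + Real.sign (2 * π * p / α - n * g) • μ) *
      starRingEnd ℂ (ψ (rhoP n p α g ω + Real.sign (2 * π * p / α - n * g) • μ))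

/-- The elementary symmetric function `ℰ_r(u) = Σ_{ν ∈ S_n(ω_r)} exp(iα⟨ν,u⟩)`. -/
def calE (n r : ℕ) (α : ℝ) (u : Fin n → ℝ) : ℂ :=
  ∑ ν ∈ orbitF n r, Complex.exp (Complex.I * (α : ℂ) * (inn ν u : ℂ))

/-- A product over ordered pairs, regrouped over the pairs `i < k`. -/
lemma prod_prod_eq_prod_lt {ι R : Type*} [Fintype ι] [LinearOrder ι] [CommMonoid R]
    (h : ι → ι → R) (hd : ∀ i, h i i = 1) :
    ∏ i, ∏ k, h i k = ∏ i, ∏ k, if i < k then h i k * h k i else 1 := by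
  have h1 : ∀ i k, h i k = (if i < k then h i k else 1) * (if k < i then h i k else 1) := by
    intro i k
    rcases lt_trichotomy i k with hik | rfl | hik
    · simp [hik, hik.asymm]
    · simp [hd]
    · simp [hik, hik.asymm]
  calc ∏ i, ∏ k, h i k
      = (∏ i, ∏ k, if i < k then h i k else 1) * ∏ i, ∏ k, if k < i then h i k else 1 := by
        simp_rw [← Finset.prod_mul_distrib]
        exact Finset.prod_congr rfl fun i _ => Finset.prod_congr rfl fun k _ => h1 i k
    _ = (∏ i, ∏ k, if i < k then h i k else 1) * ∏ i, ∏ k, if i < k then h k i else 1 := by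
        congr 1
        exact Finset.prod_comm
    _ = _ := by
        simp_rw [← Finset.prod_mul_distrib]
        refine Finset.prod_congr rfl fun i _ => Finset.prod_congr rfl fun k _ => ?_
        split_ifs <;> simp

/-- Expanding the Vandermonde determinant with rows `z_j ^ i + y * (t * z_j) ^ i`. -/
lemma sum_vandermonde_scale {R : Type*} [CommRing R] {n : ℕ} (t y : R) (z : Fin n → R) :
    ∑ J : Finset (Fin n), y ^ J.card *
        (Matrix.vandermonde fun j => if j ∈ J then t * z j else z j).det =
      (∏ i : Fin n, (1 + y * t ^ (i : ℕ))) * (Matrix.vandermonde z).det := by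
  have h1 := (Matrix.detRowAlternating (n := Fin n) (R := R)).toMultilinearMap.map_add_univ
    (fun j i => y * (t * z j) ^ (i : ℕ)) (fun j i => z j ^ (i : ℕ))
  have h2 : (∏ i : Fin n, (1 + y * t ^ (i : ℕ))) * (Matrix.vandermonde z).det =
      Matrix.det (Matrix.of fun j i : Fin n => (1 + y * t ^ (i : ℕ)) * z j ^ (i : ℕ)) := by
    rw [← Matrix.det_mul_row]
    rfl
  rw [h2]
  refine Eq.trans ?_ (h1.symm.trans ?_)
  · refine Finset.sum_congr rfl fun J _ => ?_
    have h3 : y ^ J.card = ∏ j : Fin n, if j ∈ J then y else 1 := by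
      simp
    rw [h3, ← Matrix.det_mul_column]
    refine congrArg Matrix.det ?_
    ext j i
    by_cases hj : j ∈ J <;> simp [hj, Finset.piecewise, Matrix.vandermonde_apply]
  · refine congrArg Matrix.det ?_
    ext j i
    simp [mul_pow]
    ring

/-- The sum over `|J| = r` of `∏ (t z_i - z_k) / (z_i - z_k)`, with `t = θ²` and each factor
normalised by `θ`, is an elementary symmetric polynomial in `1, t, …, t^{n-1}`. -/
lemma sum_prod_ratio {n : ℕ} (θ : ℂ) (z : Fin n → ℂ) (v : Fin n → Fin n → ℂ)
    (hz : ∀ i k, i ≠ k → z i - z k ≠ 0)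
    (hv : ∀ i k, i ≠ k → θ * v i k * (z i - z k) = θ ^ 2 * z i - z k) (r : ℕ) :
    θ ^ (r * (n - 1)) * ∑ J ∈ powersetCard r (univ : Finset (Fin n)),
        ∏ i, ∏ k, (if i ∈ J ∧ k ∉ J then v i k else 1) =
      ∑ J ∈ powersetCard r (univ : Finset (Fin n)), ∏ i ∈ J, (θ ^ 2) ^ (i : ℕ) := by
  have hdet : ∀ u : Fin n → ℂ, (Matrix.vandermonde u).det =
      ∏ i, ∏ k, if i < k then u k - u i else 1 := by
    intro u
    rw [Matrix.det_vandermonde]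
    refine Finset.prod_congr rfl fun i _ => ?_
    rw [← Finset.prod_filter]
    refine Finset.prod_congr ?_ fun _ _ => rfl
    ext k; simp
  have hJ : ∀ J : Finset (Fin n),
      (Matrix.vandermonde fun j => if j ∈ J then θ ^ 2 * z j else z j).det =
      θ ^ (J.card * (n - 1)) * (∏ i, ∏ k, (if i ∈ J ∧ k ∉ J then v i k else 1)) *
        (Matrix.vandermonde z).det := by
    intro J
    have e1 : θ ^ (J.card * (n - 1)) * (∏ i, ∏ k, (if i ∈ J ∧ k ∉ J then v i k else 1)) =
        ∏ i, ∏ k, if i ∈ J ∧ i ≠ k then θ * (if k ∈ J then 1 else v i k) else 1 := by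
      have e2 : θ ^ (J.card * (n - 1)) =
          ∏ i : Fin n, ∏ k : Fin n, if i ∈ J ∧ i ≠ k then θ else 1 := by
        have e3 : ∀ i : Fin n, (∏ k : Fin n, if i ∈ J ∧ i ≠ k then θ else 1) =
            if i ∈ J then θ ^ (n - 1) else 1 := by
          intro i
          by_cases hi : i ∈ J
          · simp only [hi, true_and, if_true]
            rw [Finset.prod_ite, Finset.prod_const, Finset.prod_const_one, mul_one]
            congr 1
            rw [Finset.filter_ne, Finset.card_erase_of_mem (Finset.mem_univ _)]
            simp
          · simp [hi]
        simp_rw [e3]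
        rw [Finset.prod_ite, Finset.prod_const, Finset.prod_const_one, mul_one, mul_comm, pow_mul]
        simp
      rw [e2]
      simp_rw [← Finset.prod_mul_distrib]
      refine Finset.prod_congr rfl fun i _ => Finset.prod_congr rfl fun k _ => ?_
      by_cases hi : i ∈ J <;> by_cases hk : k ∈ J <;> by_cases hik : i = k <;> simp_all
    rw [e1, prod_prod_eq_prod_lt _ (by simp), hdet, hdet]
    simp_rw [← Finset.prod_mul_distrib]
    refine Finset.prod_congr rfl fun i _ => Finset.prod_congr rfl fun k _ => ?_
    by_cases hik : i < k
    · have hne := hik.ne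
      have h1 := hv i k hne
      have h2 := hv k i hne.symm
      by_cases hi : i ∈ J <;> by_cases hk : k ∈ J <;> simp [hi, hk, hik, hne, hne.symm]
      · ring
      · linear_combination h1
      · linear_combination -h2
    · simp [hik]
  have hV : (Matrix.vandermonde z).det ≠ 0 := by
    rw [hdet]
    refine Finset.prod_ne_zero_iff.2 fun i _ => Finset.prod_ne_zero_iff.2 fun k _ => ?_
    split_ifs with hik
    · exact hz _ _ hik.ne'
    · exact one_ne_zero
  have hpoly : ∑ J : Finset (Fin n), (Polynomial.X : Polynomial ℂ) ^ J.card *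
        Polynomial.C (θ ^ (J.card * (n - 1)) *
          (∏ i, ∏ k, (if i ∈ J ∧ k ∉ J then v i k else 1))) =
      ∑ J : Finset (Fin n), (Polynomial.X : Polynomial ℂ) ^ J.card *
        Polynomial.C (∏ i ∈ J, (θ ^ 2) ^ (i : ℕ)) := by
    have hCV : Polynomial.C (Matrix.vandermonde z).det ≠ 0 := by simpa using hV
    refine mul_right_cancel₀ hCV ?_
    have h1 := sum_vandermonde_scale (Polynomial.C (θ ^ 2)) Polynomial.X
      (fun i => Polynomial.C (z i))
    have hC : ∀ u : Fin n → ℂ, (Matrix.vandermonde fun j => Polynomial.C (u j)).det =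
        Polynomial.C (Matrix.vandermonde u).det := by
      intro u
      rw [Matrix.det_vandermonde, Matrix.det_vandermonde]
      simp
    rw [hC z] at h1
    rw [Finset.prod_one_add] at h1
    have h2 : ∀ J : Finset (Fin n), (∏ i ∈ J, (Polynomial.X : Polynomial ℂ) *
        Polynomial.C (θ ^ 2) ^ (i : ℕ)) = Polynomial.X ^ J.card *
        Polynomial.C (∏ i ∈ J, (θ ^ 2) ^ (i : ℕ)) := by
      intro J
      rw [Finset.prod_mul_distrib, Finset.prod_const, map_prod]
      simp
    simp_rw [h2] at h1
    rw [Finset.powerset_univ] at h1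
    rw [← h1, Finset.sum_mul]
    refine Finset.sum_congr rfl fun J _ => ?_
    rw [mul_assoc, ← Polynomial.C_mul, ← hJ J, ← hC]
    congr 3
    ext j
    split_ifs <;> simp
  have hc := congrArg (fun P => Polynomial.coeff P r) hpoly
  simp only [Polynomial.finsetSum_coeff, Polynomial.coeff_X_pow_mul', Polynomial.coeff_C] at hc
  have hf : ∀ f : Finset (Fin n) → ℂ,
      (∑ J : Finset (Fin n), if J.card ≤ r then if r - J.card = 0 then f J else 0 else 0) =
        ∑ J ∈ powersetCard r (univ : Finset (Fin n)), f J := by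
    intro f
    have : powersetCard r (univ : Finset (Fin n)) =
        (univ : Finset (Finset (Fin n))).filter (fun J => J.card = r) := by
      ext J; simp [Finset.mem_powersetCard]
    rw [this, Finset.sum_filter]
    refine Finset.sum_congr rfl fun J _ => ?_
    rcases lt_trichotomy J.card r with h | h | h
    · simp [h.le, h.ne, Nat.sub_ne_zero_of_lt h]
    · simp [h]
    · simp [h.ne', h.not_ge]
  rw [hf, hf] at hc
  rw [← hc, Finset.mul_sum]
  refine Finset.sum_congr rfl fun J hJr => ?_
  rw [(Finset.mem_powersetCard.1 hJr).2]

/-- The trigonometric identity behind the ground state property: the sum of the coefficients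
`V_J` does not depend on `x`. -/
lemma sum_prod_sin_ratio {n : ℕ} (α g : ℝ) (x : Fin n → ℝ)
    (hx : ∀ i k, i ≠ k → Real.sin (α * (x i - x k) / 2) ≠ 0) (r : ℕ) :
    ((∑ J ∈ powersetCard r (univ : Finset (Fin n)), ∏ i, ∏ k, (if i ∈ J ∧ k ∉ J then
        Real.sin (α * (x i - x k + g) / 2) / Real.sin (α * (x i - x k) / 2) else 1) : ℝ) : ℂ) =
      ∑ J ∈ powersetCard r (univ : Finset (Fin n)),
        Complex.exp (Complex.I * α * (g * (r * ((n - 1 : ℕ) : ℝ) / 2 - ∑ i ∈ J, ((i : ℕ) : ℝ)) : ℝ)) := by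
  set θ : ℂ := Complex.exp (-(α * g / 2) * Complex.I) with hθ
  have hθ0 : θ ≠ 0 := Complex.exp_ne_zero _
  set w : Fin n → ℂ := fun i => Complex.exp (-(α * x i / 2) * Complex.I) with hw
  have hw0 : ∀ i, w i ≠ 0 := fun i => Complex.exp_ne_zero _
  have hsin : ∀ i k, Complex.sin (α * (x i - x k) / 2) =
      (w i / w k - w k / w i) * Complex.I / 2 := by
    intro i k
    rw [Complex.sin, hw]
    simp only [← Complex.exp_sub]
    ring_nf
  have hsing : ∀ i k, Complex.sin (α * (x i - x k + g) / 2) =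
      (θ * w i / w k - w k / (θ * w i)) * Complex.I / 2 := by
    intro i k
    rw [Complex.sin, hw, hθ]
    simp only [← Complex.exp_sub, ← Complex.exp_add]
    ring_nf
  have hne : ∀ i k, i ≠ k → w i / w k - w k / w i ≠ 0 := by
    intro i k hik h
    apply hx i k hik
    have h1 := hsin i k
    rw [h] at h1
    have h2 : ((Real.sin (α * (x i - x k) / 2) : ℝ) : ℂ) = 0 := by
      push_cast
      rw [h1]; simp
    exact_mod_cast h2
  have hI := Complex.I_ne_zero
  have hz : ∀ i k, i ≠ k → w i ^ 2 - w k ^ 2 ≠ 0 := by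
    intro i k hik h
    apply hne i k hik
    have := hw0 i
    have := hw0 k
    field_simp
    simpa using h
  have key := sum_prod_ratio θ (fun i => w i ^ 2)
    (fun i k => ((Real.sin (α * (x i - x k + g) / 2) / Real.sin (α * (x i - x k) / 2) : ℝ) : ℂ))
    hz (by
      intro i k hik
      push_cast
      rw [hsin, hsing]
      have h1 := hw0 i
      have h2 := hw0 k
      have h3 := hz i k hik
      field_simp) r
  have hθr : θ ^ (r * (n - 1)) ≠ 0 := pow_ne_zero _ hθ0
  refine mul_left_cancel₀ hθr ?_
  push_cast at key ⊢
  refine (Eq.trans ?_ key).trans ?_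
  · congr 1
    refine Finset.sum_congr rfl fun J _ => Finset.prod_congr rfl fun i _ =>
      Finset.prod_congr rfl fun k _ => ?_
    split_ifs <;> simp
  · rw [Finset.mul_sum]
    refine Finset.sum_congr rfl fun J _ => ?_
    rw [hθ]
    simp only [← Complex.exp_nat_mul]
    rw [← Complex.exp_sum, ← Complex.exp_add]
    congr 1
    have : ∀ i : Fin n, (((i : ℕ) : ℂ) * (((2 : ℕ) : ℂ) * (-(α * g / 2) * Complex.I))) =
        (-(α * g) * Complex.I) * ((i : ℕ) : ℂ) := by
      intro i; push_cast; ring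
    simp_rw [this]
    rw [← Finset.mul_sum]
    push_cast
    ring

/-- Same-sign property of `C ↦ sin (α (d g + s C) / 2)` on `[0, K]`, away from the boundary
values attained for `d = 0` and `d = n`. -/
def SameSign (n K : ℕ) (α g s : ℝ) : Prop :=
  ∀ d : ℕ, d ≤ n → ∀ C C' : ℝ, 0 ≤ C → C ≤ K → 0 ≤ C' → C' ≤ K →
    (d = 0 → 0 < C ∧ 0 < C') → (d = n → C < K ∧ C' < K) →
    0 < Real.sin (α * (d * g + s * C) / 2) * Real.sin (α * (d * g + s * C') / 2)

lemma sin_mul_sin_pos {x y : ℝ} (k : ℤ) (hx : k * π < x) (hx' : x < k * π + π)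
    (hy : k * π < y) (hy' : y < k * π + π) : 0 < Real.sin x * Real.sin y := by
  have h1 : 0 < Real.sin (x - k * π) := Real.sin_pos_of_pos_of_lt_pi (by linarith) (by linarith)
  have h2 : 0 < Real.sin (y - k * π) := Real.sin_pos_of_pos_of_lt_pi (by linarith) (by linarith)
  have h3 := mul_pos h1 h2
  rw [Real.sin_sub_int_mul_pi, Real.sin_sub_int_mul_pi] at h3
  have h4 : ((-1 : ℝ) ^ k) * ((-1 : ℝ) ^ k) = 1 := by
    rw [← mul_zpow]; simp
  calc (0:ℝ) < _ := h3
    _ = ((-1 : ℝ) ^ k * (-1 : ℝ) ^ k) * (Real.sin x * Real.sin y) := by ring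
    _ = _ := by rw [h4, one_mul]

/-- Arithmetic of the inverse `q` of `p` modulo `n`. -/
lemma mod_bounds {n p q d : ℕ} (hpq : (p * q) % n = 1 % n) (hq : q ≤ n) (hd1 : 1 ≤ d)
    (hdn : d < n) :
    d ≤ (d * p % n) * q ∧ n - d ≤ (n - d * p % n) * q ∧
      n - d ≤ (d * p % n) * (n - q) ∧ d ≤ (n - d * p % n) * (n - q) := by
  have hn : 0 < n := by omega
  have hm : d * p % n < n := Nat.mod_lt _ hn
  set m := d * p % n with hmdef
  have hmq : (n : ℤ) ∣ m * q - d := by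
    have h1 : (m * q) ≡ d [MOD n] := by
      calc m * q ≡ (d * p) * q [MOD n] := (Nat.mod_modEq _ _).mul_right _
        _ = d * (p * q) := by ring
        _ ≡ d * 1 [MOD n] := Nat.ModEq.mul_left _ hpq
        _ = d := by ring
    have := h1.symm.dvd
    push_cast at this
    exact this
  have hpos : ∀ a b : ℕ, b < n → (n : ℤ) ∣ (a : ℤ) - b → b ≤ a := by
    intro a b hb hdvd
    by_contra hlt
    have hdvd' : (n : ℤ) ∣ (b : ℤ) - a := by rwa [← dvd_neg, neg_sub] at hdvd
    have := Int.le_of_dvd (by omega) hdvd'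
    omega
  refine ⟨hpos _ _ hdn ?_, hpos _ _ (by omega) ?_, hpos _ _ (by omega) ?_, hpos _ _ hdn ?_⟩
  · push_cast; exact hmq
  · push_cast [hdn.le, hm.le]
    obtain ⟨c, hc⟩ := hmq
    exact ⟨q - 1 - c, by linear_combination -hc⟩
  · push_cast [hdn.le, hq]
    obtain ⟨c, hc⟩ := hmq
    exact ⟨m - 1 - c, by linear_combination -hc⟩
  · push_cast [hq, hm.le]
    obtain ⟨c, hc⟩ := hmq
    exact ⟨n - q - m + c, by linear_combination hc⟩

lemma sameSign_of_bound {n p q K : ℕ} {α g s : ℝ} (hα : 0 < α)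
    (hpq : (p * q) % n = 1 % n) (hq1 : 1 ≤ q) (hqn : q < n)
    (hM : n * g + s * K = p * (2 * π / α))
    (hcase : (s = 1 ∧ q * K < 2 * π / α) ∨ (s = -1 ∧ (n - q) * K < 2 * π / α)) :
    SameSign n K α g s := by
  intro d hd C C' hC hCK hC' hCK' h0 hn'
  set T := 2 * π / α with hT
  have hαT : α * T = 2 * π := by rw [hT]; field_simp
  have hT0 : 0 < T := by rw [hT]; positivity
  have hn0 : (0 : ℝ) < n := by exact_mod_cast (by omega : 0 < n)
  have hK0 : (0 : ℝ) ≤ K := by positivity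
  have hq1' : (1 : ℝ) ≤ q := by exact_mod_cast hq1
  have hqn' : (q : ℝ) + 1 ≤ n := by exact_mod_cast hqn
  have hKT : K < T := by
    rcases hcase with ⟨_, h⟩ | ⟨_, h⟩ <;> nlinarith
  -- an integer `k` with all values strictly between `k T` and `(k + 1) T`
  suffices h : ∃ k : ℤ, ∀ c : ℝ, 0 ≤ c → c ≤ K → (d = 0 → 0 < c) → (d = n → c < K) →
      k * T < d * g + s * c ∧ d * g + s * c < (k + 1) * T by
    obtain ⟨k, hk⟩ := h
    obtain ⟨a1, a2⟩ := hk C hC hCK (fun h => (h0 h).1) (fun h => (hn' h).1)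
    obtain ⟨b1, b2⟩ := hk C' hC' hCK' (fun h => (h0 h).2) (fun h => (hn' h).2)
    have e : ∀ y : ℝ, α * (y * T) / 2 = y * π := by
      intro y; linear_combination (y / 2) * hαT
    refine sin_mul_sin_pos k ?_ ?_ ?_ ?_
    · rw [← e]; gcongr
    · rw [← add_one_mul (k : ℝ) π, ← e]; gcongr
    · rw [← e]; gcongr
    · rw [← add_one_mul (k : ℝ) π, ← e]; gcongr
  have hs : s = 1 ∨ s = -1 := hcase.imp (·.1) (·.1)
  rcases Nat.eq_zero_or_pos d with rfl | hd1
  · rcases hs with rfl | rfl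
    · refine ⟨0, fun c h1 h2 h3 _ => ?_⟩
      have := h3 rfl
      push_cast; constructor <;> nlinarith
    · refine ⟨-1, fun c h1 h2 h3 _ => ?_⟩
      have := h3 rfl
      push_cast; constructor <;> nlinarith
  rcases hd.lt_or_eq with hdn | rfl
  · obtain ⟨m1, m2, m3, m4⟩ := mod_bounds hpq hqn.le hd1 hdn
    have hdiv := Nat.div_add_mod (d * p) n
    have hm : d * p % n < n := Nat.mod_lt _ (by omega)
    set m := d * p % n with hmdef
    refine ⟨((d * p / n : ℕ) : ℤ), fun c h1 h2 _ _ => ?_⟩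
    set k := d * p / n
    have hdiv' : (n : ℝ) * k + m = d * p := by exact_mod_cast hdiv
    have key : n * (d * g + s * c) = n * (k * T) + (m * T + s * (n * c - d * K)) := by
      linear_combination d * hM - T * hdiv'
    have m1' : (d : ℝ) ≤ m * q := by exact_mod_cast m1
    have m2' : (n : ℝ) - d ≤ (n - m) * q := by
      have : ((n - d : ℕ) : ℝ) ≤ (((n - m) * q : ℕ) : ℝ) := by exact_mod_cast m2
      push_cast [hdn.le, hm.le] at this; exact this
    have m3' : (n : ℝ) - d ≤ m * (n - q) := by
      have : ((n - d : ℕ) : ℝ) ≤ ((m * (n - q) : ℕ) : ℝ) := by exact_mod_cast m3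
      push_cast [hdn.le, hqn.le] at this; exact this
    have m4' : (d : ℝ) ≤ (n - m) * (n - q) := by
      have : ((d : ℕ) : ℝ) ≤ (((n - m) * (n - q) : ℕ) : ℝ) := by exact_mod_cast m4
      push_cast [hm.le, hqn.le] at this; exact this
    have hd1' : (1 : ℝ) ≤ d := by exact_mod_cast hd1
    have hdn' : (d : ℝ) + 1 ≤ n := by exact_mod_cast hdn
    have hm0 : (0 : ℝ) < m := by nlinarith
    have hm0' : (0 : ℝ) < n - m := by
      have : (m : ℝ) + 1 ≤ n := by exact_mod_cast hm
      linarith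
    have hb : 0 < m * T + s * (n * c - d * K) ∧ m * T + s * (n * c - d * K) < n * T := by
      rcases hcase with ⟨rfl, h⟩ | ⟨rfl, h⟩
      · have f1 : (m : ℝ) * (q * K) < m * T := by gcongr
        have f2 : ((n : ℝ) - m) * (q * K) < (n - m) * T := by gcongr
        have f3 : (d : ℝ) * K ≤ m * q * K := by gcongr
        have f4 : ((n : ℝ) - d) * K ≤ (n - m) * q * K := by gcongr
        have f5 : (n : ℝ) * c ≤ n * K := by gcongr
        have f6 : 0 ≤ (n : ℝ) * c := by positivity
        constructor <;> linarith
      · have f1 : (m : ℝ) * ((n - q) * K) < m * T := by gcongr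
        have f2 : ((n : ℝ) - m) * ((n - q) * K) < (n - m) * T := by gcongr
        have f3 : ((n : ℝ) - d) * K ≤ m * (n - q) * K := by gcongr
        have f4 : (d : ℝ) * K ≤ (n - m) * (n - q) * K := by gcongr
        have f5 : (n : ℝ) * c ≤ n * K := by gcongr
        have f6 : 0 ≤ (n : ℝ) * c := by positivity
        constructor <;> linarith
    push_cast
    constructor
    · refine lt_of_mul_lt_mul_left ?_ hn0.le
      rw [key]; linarith [hb.1]
    · refine lt_of_mul_lt_mul_left ?_ hn0.le
      rw [key]; linarith [hb.2]
  · rcases hs with rfl | rfl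
    · refine ⟨(p : ℤ) - 1, fun c h1 h2 _ h3 => ?_⟩
      have := h3 rfl
      push_cast; constructor <;> nlinarith
    · refine ⟨(p : ℤ), fun c h1 h2 _ h3 => ?_⟩
      have := h3 rfl
      push_cast; constructor <;> nlinarith

/-- The factor `sin (α (D + g) / 2) / sin (α D / 2)` of the coefficients `V_ν`. -/
def vfac (α g D : ℝ) : ℝ := Real.sin (α * (D + g) / 2) / Real.sin (α * D / 2)

/-- The factor of the ground state weight attached to a pair at distance `d` in the cyclic
ordering, as a function of `C = ⟨a, μ⟩`. -/
def chainPhi (α g s : ℝ) (d C : ℕ) : ℝ :=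
  Real.sin (α * (d * g + s * C) / 2) / Real.sin (α * (d * g) / 2) *
    ∏ l ∈ range C, Real.sin (α * ((d + 1) * g + s * l) / 2) /
      Real.sin (α * ((d - 1) * g + s * (l + 1)) / 2)

lemma SameSign.ne_zero {n K : ℕ} {α g s : ℝ} (h : SameSign n K α g s) {d : ℕ} (hd : d ≤ n)
    {C : ℝ} (hC : 0 ≤ C) (hCK : C ≤ K) (h0 : d = 0 → 0 < C) (hn : d = n → C < K) :
    Real.sin (α * (d * g + s * C) / 2) ≠ 0 := fun h' => by
  have := h d hd C C hC hCK hC hCK (fun e => ⟨h0 e, h0 e⟩) (fun e => ⟨hn e, hn e⟩)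
  simp [h'] at this

lemma chainPhi_succ {n K : ℕ} {α g s : ℝ} (h : SameSign n K α g s) {d C : ℕ} (hd1 : 1 ≤ d)
    (hdn : d < n) (hC : C + 1 ≤ K) :
    chainPhi α g s d (C + 1) * vfac α g (-(d * g + s * C + s)) =
      chainPhi α g s d C * vfac α g (d * g + s * C) := by
  obtain ⟨d, rfl⟩ : ∃ e, d = e + 1 := ⟨d - 1, by omega⟩
  have hC' : (C : ℝ) + 1 ≤ K := by exact_mod_cast hC
  have hC0 : (0 : ℝ) ≤ C := by positivity
  have n1 := h.ne_zero (d := d + 1) hdn.le (C := C) (by positivity) (by linarith) (by simp)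
    (fun e => by omega)
  have n2 := h.ne_zero (d := d + 1) hdn.le (C := C + 1) (by positivity) (by linarith) (by simp)
    (fun e => by omega)
  have n3 := h.ne_zero (d := d) (by omega) (C := C + 1) (by positivity) (by linarith)
    (fun _ => by positivity) (fun e => by omega)
  have n4 := h.ne_zero (d := d + 1) hdn.le (C := 0) le_rfl (by linarith) (by simp)
    (fun e => by omega)
  unfold chainPhi vfac
  rw [Finset.prod_range_succ]
  have e1 : α * (-(((d + 1 : ℕ) : ℝ) * g + s * C + s) + g) / 2 = -(α * (d * g + s * (C + 1)) / 2) := by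
    push_cast; ring
  have e2 : α * -(((d + 1 : ℕ) : ℝ) * g + s * C + s) / 2 =
      -(α * ((d + 1 : ℕ) * g + s * (C + 1)) / 2) := by
    push_cast; ring
  have e3 : α * ((((d + 1 : ℕ) : ℝ) - 1) * g + s * (C + 1)) / 2 =
      α * (d * g + s * (C + 1)) / 2 := by push_cast; ring
  have e4 : α * (((d + 1 : ℕ) : ℝ) * g + s * C + g) / 2 =
      α * ((((d + 1 : ℕ) : ℝ) + 1) * g + s * C) / 2 := by ring
  rw [e1, e2, e3, e4, Real.sin_neg, Real.sin_neg]
  simp only [mul_zero, add_zero] at n4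
  push_cast at n1 n2 n3 n4 ⊢
  field_simp

/-- Weakly increasing integer sequences with total increase at most `K`. -/
def ChainValid (n K : ℕ) (S : Fin n → ℤ) : Prop :=
  (∀ i k : Fin n, (k : ℕ) = i + 1 → S i ≤ S k) ∧
    ∀ i k : Fin n, (i : ℕ) = 0 → (k : ℕ) + 1 = n → S k - S i ≤ K

lemma monotone_of_adjacent {β : Type*} [Preorder β] {n : ℕ} {S : Fin n → β}
    (h : ∀ i k : Fin n, (k : ℕ) = i + 1 → S i ≤ S k) : Monotone S := by
  have key : ∀ m : ℕ, ∀ i k : Fin n, (k : ℕ) = i + m → S i ≤ S k := by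
    intro m
    induction m with
    | zero => intro i k hik; rw [Fin.ext (a := i) (b := k) (by omega)]
    | succ m ih =>
      intro i k hik
      exact (ih i ⟨i + m, by omega⟩ rfl).trans (h _ _ (by simp; omega))
  intro i k hik
  exact key (k - i) i k (by have : (i : ℕ) ≤ k := hik; omega)

lemma ChainValid.monotone {n K : ℕ} {S : Fin n → ℤ} (h : ChainValid n K S) : Monotone S :=
  monotone_of_adjacent h.1

lemma ChainValid.sub_le {n K : ℕ} {S : Fin n → ℤ} (h : ChainValid n K S) (i k : Fin n) :
    S k - S i ≤ K := by
  have hn : 0 < n := i.pos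
  have h1 := h.2 ⟨0, hn⟩ ⟨n - 1, by omega⟩ rfl (by simp; omega)
  have h2 : S ⟨0, hn⟩ ≤ S i := h.monotone (Fin.le_def.2 (by simp))
  have h3 : S k ≤ S ⟨n - 1, by omega⟩ := h.monotone (Fin.le_def.2 (by simp; omega))
  omega

/-- The difference of two coordinates along the chain, up to multiples of `2π/α`. -/
def chainDiff {n : ℕ} (g s : ℝ) (S : Fin n → ℝ) (i k : Fin n) : ℝ :=
  (((k : ℕ) : ℝ) - ((i : ℕ) : ℝ)) * g + s * (S k - S i)

/-- The ground state weight in chain coordinates. -/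
def chainDelta {n : ℕ} (α g s : ℝ) (S : Fin n → ℤ) : ℝ :=
  ∏ i : Fin n, ∏ k : Fin n,
    if i < k then chainPhi α g s ((k : ℕ) - (i : ℕ)) (S k - S i).toNat else 1

/-- Detailed balance: the ratio of ground state weights is a ratio of coefficients `V`. -/
lemma chainDelta_balance {n K : ℕ} {α g s : ℝ} (h : SameSign n K α g s) (J : Finset (Fin n))
    {S S' : Fin n → ℤ} (hS : ChainValid n K S) (hS' : ChainValid n K S')
    (hSS' : ∀ i, S' i = S i - if i ∈ J then 1 else 0) :
    chainDelta α g s S' * (∏ i : Fin n, ∏ k : Fin n, if i ∈ J ∧ k ∉ J then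
        vfac α g (-(chainDiff g s (fun j => (S j : ℝ)) i k + s)) else 1) =
      chainDelta α g s S * (∏ i : Fin n, ∏ k : Fin n, if i ∈ J ∧ k ∉ J then
        vfac α g (chainDiff g s (fun j => (S j : ℝ)) i k) else 1) := by
  rw [prod_prod_eq_prod_lt _ (by simp), prod_prod_eq_prod_lt (fun i k => if i ∈ J ∧ k ∉ J then
        vfac α g (chainDiff g s (fun j => (S j : ℝ)) i k) else 1) (by simp)]
  unfold chainDelta
  simp_rw [← Finset.prod_mul_distrib]
  refine Finset.prod_congr rfl fun i _ => Finset.prod_congr rfl fun k _ => ?_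
  by_cases hik : i < k
  swap
  · simp [hik]
  simp only [hik, if_true]
  have hik' : (i : ℕ) < k := hik
  obtain ⟨c, hc⟩ := Int.eq_ofNat_of_zero_le (sub_nonneg.2 (hS.monotone hik.le))
  obtain ⟨c', hc'⟩ := Int.eq_ofNat_of_zero_le (sub_nonneg.2 (hS'.monotone hik.le))
  have hcK := hS.sub_le i k
  have hcK' := hS'.sub_le i k
  have hd : (((k : ℕ) - (i : ℕ) : ℕ) : ℝ) = ((k : ℕ) : ℝ) - ((i : ℕ) : ℝ) := by
    push_cast [hik'.le]; rfl
  have hcr : (S k : ℝ) - S i = c := by exact_mod_cast hc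
  have e1 : chainDiff g s (fun j => (S j : ℝ)) i k = ((k : ℕ) - (i : ℕ) : ℕ) * g + s * c := by
    unfold chainDiff; rw [hd, ← hcr]
  have e2 : chainDiff g s (fun j => (S j : ℝ)) k i = -(((k : ℕ) - (i : ℕ) : ℕ) * g + s * c) := by
    unfold chainDiff; rw [hd, ← hcr]; ring
  rw [hc, hc', e1, e2, Int.toNat_natCast, Int.toNat_natCast]
  have hdn : (k : ℕ) - (i : ℕ) < n := by omega
  have hd1 : 1 ≤ (k : ℕ) - (i : ℕ) := by omega
  have hi := hSS' i
  have hk := hSS' k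
  by_cases hiJ : i ∈ J <;> by_cases hkJ : k ∈ J <;>
    simp only [hiJ, hkJ, if_true, if_false] at hi hk ⊢ <;> simp
  · congr 1; omega
  · have hcc : c' = c + 1 := by omega
    subst hcc
    have := chainPhi_succ h hd1 hdn (C := c) (by omega)
    convert this using 2
    ring_nf
  · have hcc : c = c' + 1 := by omega
    subst hcc
    have := chainPhi_succ h hd1 hdn (C := c') (by omega)
    rw [neg_add_eq_sub] at *
    convert this.symm using 3 <;> push_cast <;> ring
  · congr 1; omega

lemma SameSign.mul_nonneg {n K p : ℕ} {α g s : ℝ} (hα : 0 < α) (h : SameSign n K α g s)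
    (hM : n * g + s * K = p * (2 * π / α)) {d : ℕ} (hd : d ≤ n)
    {C C' : ℝ} (hC : 0 ≤ C) (hCK : C ≤ K) (hC' : 0 < C') (hCK' : C' < K) :
    0 ≤ Real.sin (α * (d * g + s * C) / 2) * Real.sin (α * (d * g + s * C') / 2) := by
  by_cases h0 : d = 0 ∧ C = 0
  · simp [h0.1, h0.2]
  by_cases hn : d = n ∧ C = K
  · rw [hn.1, hn.2, hM]
    have : α * (p * (2 * π / α)) / 2 = p * π := by field_simp
    simp [this, Real.sin_nat_mul_pi]
  refine (h d hd C C' hC hCK hC'.le hCK'.le (fun e => ⟨?_, hC'⟩) (fun e => ⟨?_, hCK'⟩)).le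
  · exact lt_of_le_of_ne hC fun e' => h0 ⟨e, e'.symm⟩
  · exact lt_of_le_of_ne hCK fun e' => hn ⟨e, e'⟩

/-- Signs of the factors of `V` at a point of the closed simplex and at an interior point. -/
lemma vfac_chainDiff_sign {n K p : ℕ} {α g s : ℝ} (hα : 0 < α) (h : SameSign n K α g s)
    (hM : n * g + s * K = p * (2 * π / α)) {S R : Fin n → ℝ}
    (hS : ∀ i k, i ≤ k → 0 ≤ S k - S i ∧ S k - S i ≤ K)
    (hR : ∀ i k, i < k → 0 < R k - R i ∧ R k - R i < K) {i k : Fin n} (hik : i ≠ k) :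
    0 ≤ vfac α g (chainDiff g s S i k) * vfac α g (chainDiff g s R i k) ∧
      vfac α g (chainDiff g s R i k) ≠ 0 := by
  have hnum : ∀ x y : ℝ, Real.sin (-x) * Real.sin (-y) = Real.sin x * Real.sin y := by
    intro x y; simp
  have hmm : ∀ a b c d : ℝ, a / b * (c / d) = (a * c) / (b * d) := by
    intro a b c d; exact div_mul_div_comm a b c d
  unfold vfac
  rw [hmm]
  rcases lt_or_gt_of_ne hik with hlt | hlt
  · obtain ⟨s1, s2⟩ := hS i k hlt.le
    obtain ⟨r1, r2⟩ := hR i k hlt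
    obtain ⟨d, hd⟩ := Nat.exists_eq_add_of_lt (show (i : ℕ) < k from hlt)
    have hkn := k.2
    have e : ∀ F : Fin n → ℝ, chainDiff g s F i k = (d + 1 : ℕ) * g + s * (F k - F i) := by
      intro F; unfold chainDiff; rw [hd]; push_cast; ring
    have e' : ∀ F : Fin n → ℝ, chainDiff g s F i k + g = (d + 2 : ℕ) * g + s * (F k - F i) := by
      intro F; rw [e]; push_cast; ring
    rw [e', e', e, e]
    refine ⟨div_nonneg ?_ ?_, div_ne_zero ?_ ?_⟩
    · exact h.mul_nonneg hα hM (by omega) s1 s2 r1 r2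
    · exact h.mul_nonneg hα hM (by omega) s1 s2 r1 r2
    · exact h.ne_zero (by omega) r1.le r2.le (fun _ => r1) (fun _ => r2)
    · exact h.ne_zero (by omega) r1.le r2.le (fun _ => r1) (fun _ => r2)
  · obtain ⟨s1, s2⟩ := hS k i hlt.le
    obtain ⟨r1, r2⟩ := hR k i hlt
    obtain ⟨d, hd⟩ := Nat.exists_eq_add_of_lt (show (k : ℕ) < i from hlt)
    have hin := i.2
    have e : ∀ F : Fin n → ℝ, α * chainDiff g s F i k / 2 =
        -(α * ((d + 1 : ℕ) * g + s * (F i - F k)) / 2) := by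
      intro F; unfold chainDiff; rw [hd]; push_cast; ring
    have e' : ∀ F : Fin n → ℝ, α * (chainDiff g s F i k + g) / 2 =
        -(α * ((d : ℕ) * g + s * (F i - F k)) / 2) := by
      intro F; unfold chainDiff; rw [hd]; push_cast; ring
    rw [e', e', e, e, hnum, hnum]
    refine ⟨div_nonneg ?_ ?_, div_ne_zero ?_ ?_⟩
    · exact h.mul_nonneg hα hM (by omega) s1 s2 r1 r2
    · exact h.mul_nonneg hα hM (by omega) s1 s2 r1 r2
    · rw [Real.sin_neg, neg_ne_zero]
      exact h.ne_zero (by omega) r1.le r2.le (fun _ => r1) (fun _ => r2)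
    · rw [Real.sin_neg, neg_ne_zero]
      exact h.ne_zero (by omega) r1.le r2.le (fun _ => r1) (fun _ => r2)

/-- If shifting a valid sequence by `J` leaves the simplex, the coefficient `V` vanishes. -/
lemma prod_vfac_eq_zero {n K p : ℕ} {α g s : ℝ} (hα : 0 < α)
    (hM : n * g + s * K = p * (2 * π / α)) (J : Finset (Fin n))
    {S S' : Fin n → ℤ} (hS : ChainValid n K S) (hS' : ¬ ChainValid n K S')
    (hSS' : ∀ i, S' i = S i - if i ∈ J then 1 else 0) :
    (∏ i : Fin n, ∏ k : Fin n, if i ∈ J ∧ k ∉ J then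
        vfac α g (chainDiff g s (fun j => (S j : ℝ)) i k) else 1) = 0 := by
  have key : ∀ i k : Fin n, i ∈ J → k ∉ J →
      Real.sin (α * (chainDiff g s (fun j => (S j : ℝ)) i k + g) / 2) = 0 →
      (∏ i : Fin n, ∏ k : Fin n, if i ∈ J ∧ k ∉ J then
        vfac α g (chainDiff g s (fun j => (S j : ℝ)) i k) else 1) = 0 := by
    intro i k hi hk h0
    refine Finset.prod_eq_zero (Finset.mem_univ i) (Finset.prod_eq_zero (Finset.mem_univ k) ?_)
    simp [hi, hk, vfac, h0]
  unfold ChainValid at hS'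
  rw [not_and_or] at hS'
  push Not at hS'
  rcases hS' with ⟨i, k, hik, hlt⟩ | ⟨i, k, hi0, hkn, hlt⟩
  · have h1 := hS.1 i k hik
    rw [hSS', hSS'] at hlt
    by_cases hiJ : i ∈ J <;> by_cases hkJ : k ∈ J <;> simp only [hiJ, hkJ, if_true, if_false] at hlt
    · omega
    · omega
    · refine key k i hkJ hiJ ?_
      have hSe : S i = S k := by omega
      have : chainDiff g s (fun j => (S j : ℝ)) k i + g = 0 := by
        unfold chainDiff; simp only [hSe, hik]; push_cast; ring
      simp [this]
    · omega
  · have h1 := hS.2 i k hi0 hkn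
    rw [hSS', hSS'] at hlt
    by_cases hiJ : i ∈ J <;> by_cases hkJ : k ∈ J <;> simp only [hiJ, hkJ, if_true, if_false] at hlt
    · omega
    · refine key i k hiJ hkJ ?_
      have hSe : (S k : ℝ) - S i = K := by
        have : S k - S i = K := by omega
        exact_mod_cast this
      have hkn' : ((k : ℕ) : ℝ) + 1 = n := by exact_mod_cast hkn
      have : chainDiff g s (fun j => (S j : ℝ)) i k + g = p * (2 * π / α) := by
        unfold chainDiff; rw [hSe, hi0, ← hM, ← hkn']; push_cast; ring
      rw [this]
      have : α * (p * (2 * π / α)) / 2 = p * π := by field_simp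
      rw [this, Real.sin_nat_mul_pi]
    · omega
    · omega

/-- The sign of `sin (α (d g + s C) / 2)` for `0 < C < K`. -/
def chainSign (K : ℕ) (α g s : ℝ) (d : ℕ) : ℝ :=
  Real.sign (Real.sin (α * (d * g + s * (K / 2)) / 2))

lemma SameSign.sign_mul_pos {n K : ℕ} {α g s : ℝ} (hK : 0 < K) (h : SameSign n K α g s) {d : ℕ}
    (hd : d ≤ n) {C : ℝ} (hC : 0 ≤ C) (hCK : C ≤ K) (h0 : d = 0 → 0 < C) (hn : d = n → C < K) :
    0 < Real.sin (α * (d * g + s * C) / 2) * chainSign K α g s d := by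
  have hK' : (0 : ℝ) < K := by exact_mod_cast hK
  have h1 := h d hd C (K / 2) hC hCK (by positivity) (by linarith)
    (fun e => ⟨h0 e, by positivity⟩) (fun e => ⟨hn e, by linarith⟩)
  unfold chainSign
  rcases pos_and_pos_or_neg_and_neg_of_mul_pos h1 with ⟨a, b⟩ | ⟨a, b⟩
  · rw [Real.sign_of_pos b]; linarith
  · rw [Real.sign_of_neg b]; linarith

lemma SameSign.sign_sq {n K : ℕ} {α g s : ℝ} (hK : 0 < K) (h : SameSign n K α g s) {d : ℕ}
    (hd : d ≤ n) : chainSign K α g s d * chainSign K α g s d = 1 := by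
  have hK' : (0 : ℝ) < K := by exact_mod_cast hK
  have h1 := h.ne_zero hd (C := K / 2) (by positivity) (by linarith) (fun _ => by positivity)
    (fun _ => by linarith)
  unfold chainSign
  rcases Real.sign_apply_eq_of_ne_zero _ h1 with e | e <;> rw [e] <;> norm_num

lemma chainSign_reflect {n K p : ℕ} {α g s : ℝ} (hα : 0 < α)
    (hM : n * g + s * K = p * (2 * π / α)) {d : ℕ} (hd : d ≤ n) :
    chainSign K α g s (n - d) = -(-1) ^ p * chainSign K α g s d := by
  unfold chainSign
  have e : α * (((n - d : ℕ) : ℝ) * g + s * (K / 2)) / 2 =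
      p * π - α * (d * g + s * (K / 2)) / 2 := by
    have : α * (p * (2 * π / α)) / 2 = p * π := by field_simp
    rw [← this, ← hM]
    push_cast [hd]
    ring
  rw [e, Real.sin_nat_mul_pi_sub]
  rcases neg_one_pow_eq_or ℝ p with h | h <;> rw [h]
  · simp [Real.sign_neg]
  · simp

/-- Telescoping product of signs. -/
lemma prod_range_sign {e : ℕ → ℝ} {n : ℕ} (he : ∀ d ≤ n, e d * e d = 1) (m : ℕ) (hm : m < n) :
    ∏ d ∈ range m, e (d + 2) * e d = e 0 * e 1 * (e m * e (m + 1)) := by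
  induction m with
  | zero =>
    have h0 := he 0 (by omega)
    have h1 := he 1 (by omega)
    simp only [Finset.range_zero, Finset.prod_empty]
    linear_combination -(e 1 * e 1) * h0 - h1
  | succ m ih =>
    rw [Finset.prod_range_succ, ih (by omega)]
    linear_combination (e 0 * e 1 * e (m + 1) * e (m + 2)) * he m (by omega)

lemma prod_range_erase {f : ℕ → ℝ} {n : ℕ} (i : Fin n) :
    (∏ k : Fin n, if i = k then 1 else f (max (i : ℕ) k - min (i : ℕ) k)) =
      (∏ d ∈ range i, f (d + 1)) * ∏ d ∈ range (n - 1 - i), f (d + 1) := by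
  have h1 : (∏ k : Fin n, if i = k then 1 else f (max (i : ℕ) k - min (i : ℕ) k)) =
      ∏ k ∈ range n, if (i : ℕ) = k then 1 else f (max (i : ℕ) k - min (i : ℕ) k) := by
    rw [← Fin.prod_univ_eq_prod_range
      (fun k => if (i : ℕ) = k then 1 else f (max (i : ℕ) k - min (i : ℕ) k))]
    simp [Fin.ext_iff]
  obtain ⟨m, hm⟩ : ∃ m, n = i + (1 + m) := ⟨n - 1 - i, by omega⟩
  have hm' : n - 1 - i = m := by omega
  rw [h1, hm']
  generalize (i : ℕ) = j at *
  subst hm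
  rw [Finset.prod_range_add, Finset.prod_range_add, ← Finset.prod_range_reflect]
  simp only [Finset.range_one, Finset.prod_singleton, add_zero, if_true, one_mul]
  congr 1
  · refine Finset.prod_congr rfl fun k hk => ?_
    have := Finset.mem_range.1 hk
    rw [if_neg (by omega)]
    congr 1
    omega
  · refine Finset.prod_congr rfl fun k hk => ?_
    rw [if_neg (by omega)]
    congr 1
    omega

/-- Positivity of a single factor of the weight, up to an explicit sign. -/
lemma chainPhi_mul_sign_pos {n K : ℕ} {α g s : ℝ} (hK : 0 < K) (h : SameSign n K α g s)
    {d C : ℕ} (hdn : d + 1 < n) (hC : C ≤ K) :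
    0 < chainPhi α g s (d + 1) C *
      (chainSign K α g s (d + 2) * chainSign K α g s d) ^ C := by
  have hC' : (C : ℝ) ≤ K := by exact_mod_cast hC
  unfold chainPhi
  have e0 : chainSign K α g s (d + 2) * chainSign K α g s d =
    chainSign K α g s (d + 2) / chainSign K α g s d := by
    have := h.sign_sq hK (d := d) (by omega)
    rw [eq_div_iff (by rintro h0; simp [h0] at this)]
    linear_combination chainSign K α g s (d + 2) * this
  rw [mul_assoc]
  refine mul_pos ?_ ?_
  · have h1 := h (d + 1) (by omega) C 0 (by positivity) hC' le_rfl (by positivity) (by simp)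
      (fun e => by omega)
    simp only [mul_zero, add_zero] at h1
    exact div_pos_iff.2 (pos_and_pos_or_neg_and_neg_of_mul_pos h1)
  · have hpow : ∀ a : ℝ, a ^ C = ∏ _l ∈ range C, a := by simp
    rw [hpow, ← Finset.prod_mul_distrib]
    refine Finset.prod_pos fun l hl => ?_
    have hl' : l + 1 ≤ C := Finset.mem_range.1 hl
    have hl'' : (l : ℝ) + 1 ≤ C := by exact_mod_cast hl'
    have h1 := h.sign_mul_pos hK (d := d + 2) (by omega) (C := l) (by positivity) (by linarith)
      (by simp) (fun _ => by linarith)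
    have h2 := h.sign_mul_pos hK (d := d) (by omega) (C := l + 1) (by positivity) (by linarith)
      (fun _ => by positivity) (fun _ => by omega)
    rw [e0, div_mul_div_comm]
    refine div_pos ?_ ?_
    · rwa [show ((d + 1 : ℕ) : ℝ) + 1 = (d + 2 : ℕ) by push_cast; ring]
    · rwa [show ((d + 1 : ℕ) : ℝ) - 1 = d by push_cast; ring]

/-- The ground state weight is positive on the lattice. -/
lemma chainDelta_pos {n K p : ℕ} {α g s : ℝ} (hα : 0 < α) (hK : 0 < K) (h : SameSign n K α g s)
    (hM : n * g + s * K = p * (2 * π / α)) {S : Fin n → ℤ} (hS : ChainValid n K S) :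
    0 < chainDelta α g s S := by
  set e := chainSign K α g s with he
  have hsq : ∀ d ≤ n, e d * e d = 1 := fun d hd => h.sign_sq hK hd
  set F : ℕ → ℝ := fun d => e (d + 1) * e (d - 1) with hF
  have hF2 : ∀ d, 1 ≤ d → d < n → F d * F d = 1 := by
    intro d h1 h2
    have a := hsq (d + 1) (by omega)
    have b := hsq (d - 1) (by omega)
    rw [hF]
    linear_combination (e (d - 1) * e (d - 1)) * a + b
  -- the product of all signs is one
  have hrow : ∀ i : Fin n, (∏ k : Fin n, if i = k then 1 else
      F (max (i : ℕ) k - min (i : ℕ) k)) = 1 := by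
    intro i
    have hi := i.2
    rw [prod_range_erase]
    have e1 : ∀ m, ∏ d ∈ range m, F (d + 1) = ∏ d ∈ range m, e (d + 2) * e d := fun m => rfl
    rw [e1, e1, prod_range_sign hsq _ hi, prod_range_sign hsq _ (by omega)]
    have r1 : e (n - 1 - i) = -(-1) ^ p * e (i + 1) := by
      rw [← chainSign_reflect hα hM (by omega)]; congr 1; omega
    have r2 : e (n - 1 - i + 1) = -(-1) ^ p * e i := by
      rw [← chainSign_reflect hα hM (by omega)]; congr 1; omega
    rw [r1, r2]
    have a0 := hsq 0 (by omega)
    have a1 := hsq 1 (by omega)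
    have ai := hsq i (by omega)
    have ai1 := hsq (i + 1) (by omega)
    have hp : ((-1 : ℝ) ^ p) * (-1) ^ p = 1 := by rw [← mul_pow]; simp
    calc _ = (e 0 * e 0) * (e 1 * e 1) * (e i * e i) * (e (i + 1) * e (i + 1)) *
          (((-1 : ℝ) ^ p) * (-1) ^ p) := by ring
      _ = 1 := by rw [a0, a1, ai, ai1, hp]; norm_num
  have hsign : (∏ i : Fin n, ∏ k : Fin n,
      if i < k then F ((k : ℕ) - i) ^ (S k - S i).toNat else 1) = 1 := by
    have hz : ∀ i k : Fin n, i < k → F ((k : ℕ) - i) ^ (S k - S i).toNat =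
        F ((k : ℕ) - i) ^ (S i) * F ((k : ℕ) - i) ^ (S k) := by
      intro i k hik
      have hik' : (i : ℕ) < k := hik
      have h2 := hF2 ((k : ℕ) - i) (by omega) (by omega)
      have h0 : F ((k : ℕ) - i) ≠ 0 := fun h0 => by simp [h0] at h2
      rw [← zpow_natCast, Int.toNat_of_nonneg (sub_nonneg.2 (hS.monotone hik.le)),
        zpow_sub₀ h0, div_eq_mul_inv, mul_comm, ← inv_zpow, inv_eq_of_mul_eq_one_left h2]
    have h3 := prod_prod_eq_prod_lt (fun i k : Fin n => if i = k then 1 else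
      F (max (i : ℕ) k - min (i : ℕ) k) ^ (S i)) (by simp)
    calc _ = _ := ?_
      _ = _ := h3.symm
      _ = 1 := ?_
    · refine Finset.prod_congr rfl fun i _ => Finset.prod_congr rfl fun k _ => ?_
      by_cases hik : i < k
      · have hik' : (i : ℕ) ≤ k := hik.le
        simp only [hik, if_true, hik.ne, hik.ne', if_false, max_eq_right hik', min_eq_left hik',
          max_eq_left hik', min_eq_right hik']
        exact hz i k hik
      · simp [hik]
    · refine Finset.prod_eq_one fun i _ => ?_
      have : (∏ k : Fin n, if i = k then 1 else F (max (i : ℕ) k - min (i : ℕ) k) ^ (S i)) =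
          (∏ k : Fin n, if i = k then 1 else F (max (i : ℕ) k - min (i : ℕ) k)) ^ (S i) := by
        rw [← Finset.prod_zpow]
        refine Finset.prod_congr rfl fun k _ => ?_
        split_ifs <;> simp
      rw [this, hrow, one_zpow]
  have : chainDelta α g s S = chainDelta α g s S * (∏ i : Fin n, ∏ k : Fin n,
      if i < k then F ((k : ℕ) - i) ^ (S k - S i).toNat else 1) := by rw [hsign, mul_one]
  rw [this]
  unfold chainDelta
  simp_rw [← Finset.prod_mul_distrib]
  refine Finset.prod_pos fun i _ => Finset.prod_pos fun k _ => ?_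
  by_cases hik : i < k
  · simp only [hik, if_true]
    obtain ⟨d, hd⟩ := Nat.exists_eq_add_of_lt (show (i : ℕ) < k from hik)
    have hd' : (k : ℕ) - i = d + 1 := by omega
    rw [hd']
    have hk := k.2
    have := hS.sub_le i k
    exact chainPhi_mul_sign_pos hK h (by omega) (by omega)
  · simp [hik]

lemma ee_succ {n : ℕ} (a : Fin n) : ee n (a + 1) = Pi.single a 1 := by
  ext i
  have hi := i.2
  have ha := a.2
  unfold ee
  by_cases h : i = a
  · simp [h]
  · have hne : ((i : ℕ) + 1) % n ≠ ((a : ℕ) + 1) % n := by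
      intro h'
      have h2 : (i : ℕ) ≡ a [MOD n] := Nat.ModEq.add_right_cancel' 1 h'
      exact h (Fin.ext (Nat.ModEq.eq_of_lt_of_lt h2 hi ha))
    simp [hne, h]

lemma ee_mod (n j : ℕ) : ee n (j % n) = ee n j := by
  ext i; simp [ee]

lemma prod_Icc_one {R : Type*} [CommMonoid R] (n : ℕ) (f : ℕ → R) :
    ∏ j ∈ Icc 1 n, f j = ∏ a : Fin n, f (a + 1) := by
  rw [Fin.prod_univ_eq_prod_range (fun a => f (a + 1)), ← Finset.prod_image (g := fun a => a + 1)
    (by intro a _ b _ h; simpa using h)]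
  refine Finset.prod_congr ?_ fun _ _ => rfl
  ext j
  simp only [Finset.mem_Icc, Finset.mem_image, Finset.mem_range]
  exact ⟨fun h => ⟨j - 1, by omega, by omega⟩, by rintro ⟨a, h, rfl⟩; omega⟩

lemma inn_single_sub {n : ℕ} (a b : Fin n) (x : Fin n → ℝ) :
    inn (Pi.single a 1 - Pi.single b 1) x = x a - x b := by
  simp [inn, sub_mul, Finset.sum_sub_distrib, Pi.single_apply]

lemma inn_ee_sub {n : ℕ} (a b : Fin n) (x : Fin n → ℝ) :
    inn (ee n (a + 1) - ee n (b + 1)) x = x a - x b := by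
  rw [ee_succ, ee_succ, inn_single_sub]

lemma inn_add_right {n : ℕ} (v x y : Fin n → ℝ) : inn v (x + y) = inn v x + inn v y := by
  simp [inn, mul_add, Finset.sum_add_distrib]

lemma inn_smul_right {n : ℕ} (v x : Fin n → ℝ) (c : ℝ) : inn v (c • x) = c * inn v x := by
  simp only [inn, Finset.mul_sum, Pi.smul_apply, smul_eq_mul]
  exact Finset.sum_congr rfl fun _ _ => by ring

lemma inn_sum_right {n : ℕ} {ι : Type*} (v : Fin n → ℝ) (t : Finset ι) (x : ι → Fin n → ℝ) :
    inn v (∑ j ∈ t, x j) = ∑ j ∈ t, inn v (x j) := by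
  simp only [inn, Finset.sum_apply, Finset.mul_sum]
  exact Finset.sum_comm

lemma inn_smul_left {n : ℕ} (v x : Fin n → ℝ) (c : ℝ) : inn (c • v) x = c * inn v x := by
  simp only [inn, Finset.mul_sum, Pi.smul_apply, smul_eq_mul, mul_assoc]

lemma inn_sum_left {n : ℕ} {ι : Type*} (x : Fin n → ℝ) (t : Finset ι) (v : ι → Fin n → ℝ) :
    inn (∑ j ∈ t, v j) x = ∑ j ∈ t, inn (v j) x := by
  simp only [inn, Finset.sum_apply, Finset.sum_mul]
  exact Finset.sum_comm

/-- The weight of the orbit of `ω_r` attached to a subset `J` of cardinality `r`. -/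
def subsetWeight {n : ℕ} (r : ℕ) (J : Finset (Fin n)) : Fin n → ℝ :=
  fun i => (if i ∈ J then 1 else 0) - (r : ℝ) / n

lemma subsetWeight_injective {n : ℕ} (r : ℕ) :
    Function.Injective (subsetWeight (n := n) r) := by
  intro J J' h
  ext i
  have h1 := congrFun h i
  unfold subsetWeight at h1
  by_cases hi : i ∈ J <;> by_cases hi' : i ∈ J' <;>
    simp only [hi, hi', if_true, if_false] at h1 ⊢ <;> linarith

lemma orbitF_eq_image {n r : ℕ} (hr : r ≤ n) :
    orbitF n r = (powersetCard r (univ : Finset (Fin n))).image (subsetWeight r) := by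
  have hcard : (univ.filter fun i : Fin n => (i : ℕ) + 1 ≤ r).card = r := by
    have := Fin.card_filter_val_lt (n := n) (m := r)
    rw [min_eq_right hr] at this
    exact this
  ext ν
  simp only [orbitF, Finset.mem_image, Finset.mem_univ, true_and, Finset.mem_powersetCard]
  constructor
  · rintro ⟨σ, rfl⟩
    refine ⟨univ.filter fun i => (σ i : ℕ) + 1 ≤ r, ⟨Finset.subset_univ _, ?_⟩, ?_⟩
    · refine Eq.trans ?_ hcard
      exact Finset.card_bij (fun i _ => σ i) (by simp) (by simp)
        (fun b hb => ⟨σ.symm b, by simpa using hb, by simp⟩)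
    · ext i; simp [subsetWeight, omegaStd]
  · rintro ⟨J, ⟨-, hJ⟩, rfl⟩
    let e : {i // i ∈ J} ≃ {i // i ∈ univ.filter fun i : Fin n => (i : ℕ) + 1 ≤ r} :=
      Finset.equivOfCardEq (hJ.trans hcard.symm)
    refine ⟨e.extendSubtype, ?_⟩
    ext i
    by_cases hi : i ∈ J
    · have := e.extendSubtype_mem i hi
      simp only [Finset.mem_filter, Finset.mem_univ, true_and] at this
      simp [subsetWeight, omegaStd, hi, this]
    · have := e.extendSubtype_not_mem i hi
      simp only [Finset.mem_filter, Finset.mem_univ, true_and] at this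
      simp [subsetWeight, omegaStd, hi, this]

lemma sum_orbitF {n r : ℕ} (hr : r ≤ n) {R : Type*} [AddCommMonoid R] (f : (Fin n → ℝ) → R) :
    ∑ ν ∈ orbitF n r, f ν =
      ∑ J ∈ powersetCard r (univ : Finset (Fin n)), f (subsetWeight r J) := by
  rw [orbitF_eq_image hr, Finset.sum_image fun _ _ _ _ h => subsetWeight_injective r h]

lemma inOrbit_subsetWeight {n r : ℕ} (hr : r ≤ n) {J : Finset (Fin n)}
    (hJ : J ∈ powersetCard r (univ : Finset (Fin n))) : inOrbit n r (subsetWeight r J) := by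
  have h : subsetWeight r J ∈ orbitF n r := by
    rw [orbitF_eq_image hr]; exact Finset.mem_image_of_mem _ hJ
  simp only [orbitF, Finset.mem_image, Finset.mem_univ, true_and] at h
  obtain ⟨σ, hσ⟩ := h
  exact ⟨σ, hσ.symm⟩

lemma sum_subsetWeight {n r : ℕ} (hn : 0 < n) {J : Finset (Fin n)}
    (hJ : J ∈ powersetCard r (univ : Finset (Fin n))) : ∑ i, subsetWeight r J i = 0 := by
  have hn' : (n : ℝ) ≠ 0 := by exact_mod_cast hn.ne'
  have hc := (Finset.mem_powersetCard.1 hJ).2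
  simp only [subsetWeight, Finset.sum_sub_distrib]
  simp [hc]
  field_simp
  simp

lemma Vnu_subsetWeight {n r : ℕ} (α g : ℝ) (J : Finset (Fin n)) (x : Fin n → ℝ) :
    Vnu n α g (subsetWeight r J) x =
      ∏ i, ∏ k, if i ∈ J ∧ k ∉ J then vfac α g (x i - x k) else 1 := by
  unfold Vnu
  rw [prod_Icc_one]
  refine Finset.prod_congr rfl fun i _ => ?_
  rw [prod_Icc_one]
  refine Finset.prod_congr rfl fun k _ => ?_
  simp only [inn_ee_sub]
  have hiff : ((i : ℕ) + 1 ≠ (k : ℕ) + 1 ∧ subsetWeight r J i - subsetWeight r J k = 1) ↔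
      (i ∈ J ∧ k ∉ J) := by
    unfold subsetWeight
    by_cases hi : i ∈ J <;> by_cases hk : k ∈ J <;> simp [hi, hk]
    · intro h
      exact hk (Fin.ext h ▸ hi)
    · intro _ h
      linarith
  simp only [hiff]
  rfl

lemma sum_omegaStd {n : ℕ} (hn : 0 < n) (i : Fin n) :
    (∑ k ∈ Icc 1 (n - 1), omegaStd n k) i = ((n - 1 : ℕ) : ℝ) / 2 - (i : ℕ) := by
  have hn' : (n : ℝ) ≠ 0 := by exact_mod_cast hn.ne'
  rw [Finset.sum_apply]
  simp only [omegaStd, Finset.sum_sub_distrib]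
  have h1 : (∑ k ∈ Icc 1 (n - 1), if (i : ℕ) + 1 ≤ k then (1 : ℝ) else 0) =
      ((n - 1 : ℕ) : ℝ) - (i : ℕ) := by
    rw [← Finset.sum_filter, Finset.sum_const, nsmul_eq_mul, mul_one]
    have : (Icc 1 (n - 1)).filter (fun k => (i : ℕ) + 1 ≤ k) = Icc ((i : ℕ) + 1) (n - 1) := by
      ext k; simp only [Finset.mem_filter, Finset.mem_Icc]; omega
    rw [this, Nat.card_Icc]
    have hi := i.2
    rw [show n - 1 + 1 - ((i : ℕ) + 1) = n - 1 - i by omega, Nat.cast_sub (by omega)]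
  have h2 : (∑ k ∈ Icc 1 (n - 1), (k : ℝ) / n) = ((n - 1 : ℕ) : ℝ) / 2 := by
    rw [← Finset.sum_div]
    have h3 : ∀ m : ℕ, ∑ k ∈ Icc 1 m, (k : ℝ) = m * (m + 1) / 2 := by
      intro m
      induction m with
      | zero => simp
      | succ m ih => rw [Finset.sum_Icc_succ_top (by omega), ih]; push_cast; ring
    rw [h3]
    push_cast [hn]
    field_simp
    ring
  rw [h1, h2]
  ring

lemma calE_eq {n r : ℕ} (hn : 0 < n) (hr : r ≤ n) (α g : ℝ) :
    calE n r α (g • ∑ k ∈ Icc 1 (n - 1), omegaStd n k) =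
      ∑ J ∈ powersetCard r (univ : Finset (Fin n)),
        Complex.exp (Complex.I * α *
          (g * (r * ((n - 1 : ℕ) : ℝ) / 2 - ∑ i ∈ J, ((i : ℕ) : ℝ)) : ℝ)) := by
  unfold calE
  rw [sum_orbitF hr]
  refine Finset.sum_congr rfl fun J hJ => ?_
  congr 3
  have hc := (Finset.mem_powersetCard.1 hJ).2
  have hn' : (n : ℝ) ≠ 0 := by exact_mod_cast hn.ne'
  rw [inn_smul_right]
  congr 1
  have hsum : ∑ i : Fin n, (((n - 1 : ℕ) : ℝ) / 2 - ((i : ℕ) : ℝ)) = 0 := by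
    rw [Finset.sum_sub_distrib, Fin.sum_univ_eq_sum_range (fun i => (i : ℝ)),
      ← Nat.cast_sum]
    have := Finset.sum_range_id_mul_two n
    have h2 : ((∑ i ∈ range n, i : ℕ) : ℝ) * 2 = n * ((n - 1 : ℕ) : ℝ) := by exact_mod_cast this
    simp
    push_cast at h2
    linarith
  unfold inn subsetWeight
  simp_rw [sum_omegaStd hn, sub_mul, Finset.sum_sub_distrib, ← Finset.mul_sum, hsum]
  simp only [ite_mul, one_mul, zero_mul, Finset.sum_ite_mem, Finset.univ_inter]
  rw [Finset.sum_sub_distrib, Finset.sum_const, hc]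
  simp
  ring

/-- The coordinates are listed by `β` in the cyclic order `p, 2p, …, np` modulo `n`. -/
def IsChainOrder (n p : ℕ) (β : Equiv.Perm (Fin n)) : Prop :=
  ∀ i : Fin n, ((β i : ℕ) + 1) % n = ((i : ℕ) + 1) * p % n

lemma exists_isChainOrder {n p : ℕ} (hn : 0 < n) (hcop : Nat.Coprime p n) :
    ∃ β : Equiv.Perm (Fin n), IsChainOrder n p β := by
  let f : Fin n → Fin n := fun i => ⟨(((i : ℕ) + 1) * p + (n - 1)) % n, Nat.mod_lt _ hn⟩
  have hf : ∀ i : Fin n, ((f i : ℕ) + 1) % n = ((i : ℕ) + 1) * p % n := by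
    intro i
    simp only [f, Nat.mod_add_mod]
    rw [add_assoc, Nat.sub_add_cancel hn, Nat.add_mod_right]
  have hinj : Function.Injective f := by
    intro i k hik
    have h1 : ((i : ℕ) + 1) * p ≡ ((k : ℕ) + 1) * p [MOD n] := by
      have h2 := hf i
      rw [hik, hf k] at h2
      exact h2.symm
    have h3 : (i : ℕ) + 1 ≡ (k : ℕ) + 1 [MOD n] :=
      Nat.ModEq.cancel_right_of_coprime (Nat.coprime_comm.1 hcop) h1
    exact Fin.ext (Nat.ModEq.eq_of_lt_of_lt (Nat.ModEq.add_right_cancel' 1 h3) i.2 k.2)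
  exact ⟨Equiv.ofBijective f (Finite.injective_iff_bijective.1 hinj), hf⟩

lemma IsChainOrder.ee_eq {n p : ℕ} {β : Equiv.Perm (Fin n)} (hβ : IsChainOrder n p β)
    (i : Fin n) : ee n (((i : ℕ) + 1) * p) = Pi.single (β i) 1 := by
  rw [← ee_mod, ← hβ i, ee_mod, ee_succ]

lemma IsChainOrder.aa_eq {n p : ℕ} {β : Equiv.Perm (Fin n)} (hβ : IsChainOrder n p β)
    {i k : Fin n} (hik : (k : ℕ) = i + 1) :
    aa n p (((i : ℕ) + 1) * p % n) = Pi.single (β i) 1 - Pi.single (β k) 1 := by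
  unfold aa
  rw [ee_mod, hβ.ee_eq, ← hβ.ee_eq k, ← ee_mod n (_ + p), Nat.mod_add_mod, ee_mod, hik]
  congr 2
  ring

lemma IsChainOrder.inn_aa {n p : ℕ} {β : Equiv.Perm (Fin n)} (hβ : IsChainOrder n p β)
    {i k : Fin n} (hik : (k : ℕ) = i + 1) (x : Fin n → ℝ) :
    inn (aa n p (((i : ℕ) + 1) * p % n)) x = x (β i) - x (β k) := by
  rw [hβ.aa_eq hik, inn_single_sub]

lemma chain_index_bounds {n p : ℕ} (hcop : Nat.Coprime p n)
    {i : ℕ} (hi : i + 1 < n) : 1 ≤ (i + 1) * p % n ∧ (i + 1) * p % n ≤ n - 1 := by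
  have h1 := Nat.mod_lt ((i + 1) * p) (show n > 0 by omega)
  refine ⟨Nat.one_le_iff_ne_zero.2 fun h => ?_, by omega⟩
  have h2 : n ∣ (i + 1) * p := Nat.dvd_of_mod_eq_zero h
  have h3 := Nat.le_of_dvd (by omega) ((Nat.coprime_comm.1 hcop).dvd_of_dvd_mul_right h2)
  omega

lemma IsChainOrder.exists_index {n p : ℕ} {β : Equiv.Perm (Fin n)} (hβ : IsChainOrder n p β)
    {j : ℕ} (hj1 : 1 ≤ j) (hjn : j ≤ n - 1) :
    ∃ i k : Fin n, (k : ℕ) = i + 1 ∧ j = ((i : ℕ) + 1) * p % n := by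
  obtain ⟨i, hi⟩ := β.surjective ⟨j - 1, by omega⟩
  have h1 := hβ i
  rw [hi] at h1
  simp only [Nat.sub_add_cancel hj1] at h1
  rw [Nat.mod_eq_of_lt (by omega)] at h1
  have h2 : (i : ℕ) + 1 < n := by
    rcases Nat.lt_or_ge ((i : ℕ) + 1) n with h | h
    · exact h
    · have h3 : (i : ℕ) + 1 = n := by omega
      rw [h3, Nat.mul_mod_right] at h1
      omega
  exact ⟨i, ⟨i + 1, h2⟩, rfl, h1⟩

lemma IsChainOrder.sum_index {n p : ℕ} {β : Equiv.Perm (Fin n)} (hβ : IsChainOrder n p β)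
    (hcop : Nat.Coprime p n) (f : ℕ → ℝ) :
    ∑ j ∈ Icc 1 (n - 1), f j = ∑ i ∈ range (n - 1), f ((i + 1) * p % n) := by
  symm
  refine Finset.sum_bij (fun i _ => (i + 1) * p % n) ?_ ?_ ?_ fun _ _ => rfl
  · intro i hi
    rw [Finset.mem_range] at hi
    exact Finset.mem_Icc.2 (chain_index_bounds hcop (by omega))
  · intro i hi k hk hik
    rw [Finset.mem_range] at hi hk
    have h3 : i + 1 ≡ k + 1 [MOD n] :=
      Nat.ModEq.cancel_right_of_coprime (Nat.coprime_comm.1 hcop) hik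
    exact Nat.ModEq.eq_of_lt_of_lt (Nat.ModEq.add_right_cancel' 1 h3) (by omega) (by omega)
  · intro j hj
    obtain ⟨i, k, hik, h⟩ := hβ.exists_index (Finset.mem_Icc.1 hj).1 (Finset.mem_Icc.1 hj).2
    exact ⟨i, Finset.mem_range.2 (by omega), h.symm⟩

lemma IsChainOrder.sum_inn_aa {n p : ℕ} {β : Equiv.Perm (Fin n)} (hβ : IsChainOrder n p β)
    (hcop : Nat.Coprime p n) {i k : Fin n} (hi : (i : ℕ) = 0) (hk : (k : ℕ) + 1 = n)
    (x : Fin n → ℝ) :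
    ∑ j ∈ Icc 1 (n - 1), inn (aa n p j) x = x (β i) - x (β k) := by
  rw [hβ.sum_index hcop]
  let y : ℕ → ℝ := fun m => if h : m < n then x (β ⟨m, h⟩) else 0
  have h1 : ∀ m ∈ range (n - 1), inn (aa n p ((m + 1) * p % n)) x = y m - y (m + 1) := by
    intro m hm
    rw [Finset.mem_range] at hm
    have hm0 : m < n := by omega
    have hm1 : m + 1 < n := by omega
    rw [hβ.inn_aa (i := ⟨m, hm0⟩) (k := ⟨m + 1, hm1⟩) rfl]
    simp [y, hm0, hm1]
  rw [Finset.sum_congr rfl h1, Finset.sum_range_sub']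
  have hi' : i = ⟨0, by omega⟩ := Fin.ext hi
  have hk' : k = ⟨n - 1, by omega⟩ := Fin.ext (by simp; omega)
  have h0 : 0 < n := by omega
  simp [y, hi', hk', h0]

lemma exists_chain_lift {n : ℕ} {x : Fin n → ℝ} {a T : ℝ}
    (h : ∀ i k : Fin n, (k : ℕ) = i + 1 → ∃ z : ℤ, x i - x k = a + T * z) :
    ∃ S : Fin n → ℤ, ∀ i k : Fin n,
      x i - x k = (((k : ℕ) : ℝ) - ((i : ℕ) : ℝ)) * a + T * ((S k : ℝ) - S i) := by
  have key : ∀ (m : ℕ) (k : Fin n), (k : ℕ) = m →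
      ∃ z : ℤ, x ⟨0, k.pos⟩ - x k = ((k : ℕ) : ℝ) * a + T * z := by
    intro m
    induction m with
    | zero =>
      intro k hk
      refine ⟨0, ?_⟩
      rw [show (⟨0, k.pos⟩ : Fin n) = k from Fin.ext hk.symm, hk]
      simp
    | succ m ih =>
      intro k hk
      obtain ⟨z, hz⟩ := ih ⟨m, by omega⟩ rfl
      obtain ⟨w, hw⟩ := h ⟨m, by omega⟩ k hk
      refine ⟨z + w, ?_⟩
      rw [hk]
      push_cast at hz ⊢
      linear_combination hz + hw
  choose S hS using fun k : Fin n => key k k rfl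
  refine ⟨S, fun i k => ?_⟩
  linear_combination hS k - hS i

lemma eq_of_sum_eq_of_chain_sub_eq {n : ℕ} (β : Equiv.Perm (Fin n)) {x y : Fin n → ℝ}
    (hsum : ∑ i, x i = ∑ i, y i)
    (h : ∀ i k : Fin n, (k : ℕ) = i + 1 → x (β i) - x (β k) = y (β i) - y (β k)) : x = y := by
  obtain ⟨S, hS⟩ := exists_chain_lift (x := fun i => x (β i) - y (β i)) (a := 0) (T := 0)
    fun i k hik => ⟨0, by linear_combination h i k hik⟩
  ext j
  have hc : ∀ k, x k - y k = x j - y j := by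
    intro k
    have := hS (β.symm k) (β.symm j)
    simp only [Equiv.apply_symm_apply] at this
    linear_combination this
  have h0 : ∑ k, (x k - y k) = 0 := by rw [Finset.sum_sub_distrib, hsum, sub_self]
  simp only [hc, Finset.sum_const, Finset.card_univ, Fintype.card_fin, nsmul_eq_mul] at h0
  have hn : (n : ℝ) ≠ 0 := by exact_mod_cast j.pos.ne'
  have := (mul_eq_zero.1 h0).resolve_left hn
  linarith

/-- `ω_1, …, ω_{n-1}` are the fundamental weights dual to the simple roots `a_{j,p}`. -/
structure IsDualBasis (n p : ℕ) (ω : ℕ → Fin n → ℝ) : Prop where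
  sum_eq_zero : ∀ k : ℕ, 1 ≤ k → k ≤ n - 1 → ∑ i, ω k i = 0
  inn_eq : ∀ j : ℕ, 1 ≤ j → j ≤ n - 1 → ∀ k : ℕ, 1 ≤ k → k ≤ n - 1 →
    inn (aa n p j) (ω k) = if j = k then (1 : ℝ) else 0

lemma IsDualBasis.inn_sum {n p : ℕ} {ω : ℕ → Fin n → ℝ} (hω : IsDualBasis n p ω)
    {t : Finset ℕ} (ht : t ⊆ Icc 1 (n - 1)) (m : ℕ → ℝ) {j : ℕ} (hj : j ∈ Icc 1 (n - 1)) :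
    inn (aa n p j) (∑ k ∈ t, m k • ω k) = if j ∈ t then m j else 0 := by
  rw [inn_sum_right]
  have : ∀ k ∈ t, inn (aa n p j) (m k • ω k) = if j = k then m k else 0 := by
    intro k hk
    have hk' := Finset.mem_Icc.1 (ht hk)
    have hj' := Finset.mem_Icc.1 hj
    rw [inn_smul_right, hω.inn_eq j hj'.1 hj'.2 k hk'.1 hk'.2]
    split_ifs <;> simp
  rw [Finset.sum_congr rfl this, Finset.sum_ite_eq]

lemma IsDualBasis.inn_rhoP {n p : ℕ} {ω : ℕ → Fin n → ℝ} (hω : IsDualBasis n p ω)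
    (hp1 : 1 ≤ p) (α g : ℝ) {j : ℕ} (hj : j ∈ Icc 1 (n - 1)) :
    ∃ z : ℤ, inn (aa n p j) (rhoP n p α g ω) = g + 2 * π / α * z := by
  have hj' := Finset.mem_Icc.1 hj
  unfold rhoP
  rw [inn_add_right, Finset.smul_sum, Finset.smul_sum,
    hω.inn_sum (fun k hk => by rw [Finset.mem_Icc] at hk ⊢; omega) (fun _ => g) hj,
    hω.inn_sum (fun k hk => by rw [Finset.mem_Icc] at hk ⊢; omega)
      (fun _ => g - 2 * π / α) hj]
  by_cases h : j ≤ n - p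
  · refine ⟨0, ?_⟩
    rw [if_pos (Finset.mem_Icc.2 ⟨hj'.1, h⟩), if_neg (by rw [Finset.mem_Icc]; omega)]
    simp
  · refine ⟨-1, ?_⟩
    rw [if_neg (by rw [Finset.mem_Icc]; omega), if_pos (Finset.mem_Icc.2 ⟨by omega, hj'.2⟩)]
    push_cast
    ring

lemma IsDualBasis.rhoP_sub {n p : ℕ} {ω : ℕ → Fin n → ℝ} (hω : IsDualBasis n p ω)
    {β : Equiv.Perm (Fin n)} (hβ : IsChainOrder n p β) (hcop : Nat.Coprime p n)
    (hp1 : 1 ≤ p) (α g : ℝ) (i k : Fin n) :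
    ∃ w : ℤ, rhoP n p α g ω (β i) - rhoP n p α g ω (β k) =
      (((k : ℕ) : ℝ) - ((i : ℕ) : ℝ)) * g + 2 * π / α * w := by
  obtain ⟨S, hS⟩ := exists_chain_lift (x := fun i => rhoP n p α g ω (β i)) (a := g)
    (T := 2 * π / α) (fun i k hik => by
      rw [← hβ.inn_aa hik]
      exact hω.inn_rhoP hp1 α g (Finset.mem_Icc.2 (chain_index_bounds hcop (by omega))))
  exact ⟨S k - S i, by simpa using hS i k⟩

/-- `S` records, up to an additive constant, the coordinates of `-μ` along the chain `β`. -/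
def IsChainLift {n : ℕ} (β : Equiv.Perm (Fin n)) (μ : Fin n → ℝ) (S : Fin n → ℤ) : Prop :=
  ∀ i k : Fin n, μ (β i) - μ (β k) = (S k : ℝ) - S i

lemma IsDualBasis.mem_Lam_iff {n p K : ℕ} {ω : ℕ → Fin n → ℝ} (hω : IsDualBasis n p ω)
    {β : Equiv.Perm (Fin n)} (hβ : IsChainOrder n p β) (hcop : Nat.Coprime p n) (hn : 0 < n)
    {μ : Fin n → ℝ} :
    μ ∈ Lam n K ω ↔ ∑ i, μ i = 0 ∧ ∃ S : Fin n → ℤ, ChainValid n K S ∧ IsChainLift β μ S := by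
  constructor
  · rintro ⟨m, hm, rfl⟩
    have hinn : ∀ j ∈ Icc 1 (n - 1),
        inn (aa n p j) (∑ j ∈ Icc 1 (n - 1), (m j : ℝ) • ω j) = m j := fun j hj => by
      rw [hω.inn_sum (fun _ h => h) (fun j => (m j : ℝ)) hj, if_pos hj]
    have hadj : ∀ i k : Fin n, (k : ℕ) = i + 1 →
        (∑ j ∈ Icc 1 (n - 1), (m j : ℝ) • ω j) (β i) -
          (∑ j ∈ Icc 1 (n - 1), (m j : ℝ) • ω j) (β k) = m (((i : ℕ) + 1) * p % n) :=
      fun i k hik => by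
        rw [← hβ.inn_aa hik,
          hinn _ (Finset.mem_Icc.2 (chain_index_bounds hcop (by omega)))]
    obtain ⟨S, hS⟩ := exists_chain_lift
      (x := fun i => (∑ j ∈ Icc 1 (n - 1), (m j : ℝ) • ω j) (β i)) (a := 0) (T := 1)
      (fun i k hik => ⟨m (((i : ℕ) + 1) * p % n), by rw [hadj i k hik]; simp⟩)
    have hS' : IsChainLift β (∑ j ∈ Icc 1 (n - 1), (m j : ℝ) • ω j) S :=
      fun i k => by simpa using hS i k
    refine ⟨?_, S, ⟨fun i k hik => ?_, fun i k hi hk => ?_⟩, hS'⟩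
    · simp only [Finset.sum_apply]
      rw [Finset.sum_comm]
      refine Finset.sum_eq_zero fun j hj => ?_
      have hj' := Finset.mem_Icc.1 hj
      simp only [Pi.smul_apply, smul_eq_mul]
      rw [← Finset.mul_sum, hω.sum_eq_zero j hj'.1 hj'.2, mul_zero]
    · have h1 := hS' i k
      rw [hadj i k hik] at h1
      have h2 : (0 : ℝ) ≤ m (((i : ℕ) + 1) * p % n) := by positivity
      have h3 : (S i : ℝ) ≤ S k := by linarith
      exact_mod_cast h3
    · have h1 := hS' i k
      rw [← hβ.sum_inn_aa hcop hi hk, Finset.sum_congr rfl hinn] at h1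
      have h3 : (S k : ℝ) - S i ≤ K := by linarith
      exact_mod_cast h3
  · rintro ⟨hsum, S, hS, hμ⟩
    have hm : ∀ i k : Fin n, (k : ℕ) = i + 1 →
        (⌊inn (aa n p (((i : ℕ) + 1) * p % n)) μ⌋.toNat : ℝ) = μ (β i) - μ (β k) := by
      intro i k hik
      rw [hβ.inn_aa hik, hμ i k]
      have h1 := hS.1 i k hik
      have h2 : ⌊(S k : ℝ) - S i⌋ = S k - S i := by
        rw [← Int.cast_sub, Int.floor_intCast]
      rw [h2, ← Int.cast_natCast, Int.toNat_of_nonneg (by omega), Int.cast_sub]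
    have hm' : ∀ j ∈ Icc 1 (n - 1), (⌊inn (aa n p j) μ⌋.toNat : ℝ) = inn (aa n p j) μ := by
      intro j hj
      obtain ⟨i, k, hik, rfl⟩ :=
        hβ.exists_index (Finset.mem_Icc.1 hj).1 (Finset.mem_Icc.1 hj).2
      rw [hm i k hik, hβ.inn_aa hik]
    refine ⟨fun j => ⌊inn (aa n p j) μ⌋.toNat, ?_, ?_⟩
    · rw [Finset.sum_congr rfl hm', hβ.sum_inn_aa hcop (i := ⟨0, hn⟩)
        (k := ⟨n - 1, by omega⟩) rfl (by simp; omega), hμ]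
      have := hS.2 ⟨0, hn⟩ ⟨n - 1, by omega⟩ rfl (by simp; omega)
      exact_mod_cast this
    · refine eq_of_sum_eq_of_chain_sub_eq β ?_ fun i k hik => ?_
      · rw [hsum]
        simp only [Finset.sum_apply]
        rw [Finset.sum_comm]
        symm
        refine Finset.sum_eq_zero fun j hj => ?_
        have hj' := Finset.mem_Icc.1 hj
        simp only [Pi.smul_apply, smul_eq_mul]
        rw [← Finset.mul_sum, hω.sum_eq_zero j hj'.1 hj'.2, mul_zero]
      · have hj := Finset.mem_Icc.2 (chain_index_bounds (n := n) hcop (i := i) (by omega))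
        rw [← hβ.inn_aa hik, ← hβ.inn_aa hik,
          hω.inn_sum (fun _ h => h) (fun j => (⌊inn (aa n p j) μ⌋.toNat : ℝ)) hj, if_pos hj,
          hm' _ hj]

lemma IsChainOrder.inPosRoots_iff {n p : ℕ} {β : Equiv.Perm (Fin n)}
    (hβ : IsChainOrder n p β) (hcop : Nat.Coprime p n) (i k : Fin n) :
    inPosRoots n p (ee n (β i + 1) - ee n (β k + 1)) ↔ i < k := by
  constructor
  · rintro ⟨⟨j, hj, l, hl, hjl, hv⟩, c, hc⟩
    rw [Finset.mem_Icc] at hj hl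
    have hne : i ≠ k := by
      rintro rfl
      obtain ⟨a, rfl⟩ : ∃ a, j = a + 1 := ⟨j - 1, by omega⟩
      obtain ⟨b, rfl⟩ : ∃ b, l = b + 1 := ⟨l - 1, by omega⟩
      rw [sub_self, ee_succ (⟨a, by omega⟩ : Fin n), ee_succ (⟨b, by omega⟩ : Fin n)] at hv
      have h1 := congrFun hv ⟨a, by omega⟩
      have h2 : (⟨a, by omega⟩ : Fin n) ≠ ⟨b, by omega⟩ := by
        intro h; exact hjl (by rw [Fin.mk.inj h])
      simp [h2] at h1
    let h : Fin n → ℝ := fun b => -((β.symm b : ℕ) : ℝ)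
    have h1 : inn (ee n (β i + 1) - ee n (β k + 1)) h = ((k : ℕ) : ℝ) - (i : ℕ) := by
      rw [inn_ee_sub]
      simp only [h, Equiv.symm_apply_apply]
      ring
    rw [hc, inn_sum_left] at h1
    have h2 : 0 ≤ ∑ j ∈ Icc 1 (n - 1), inn ((c j : ℝ) • aa n p j) h := by
      refine Finset.sum_nonneg fun j hj => ?_
      obtain ⟨i, k, hik, rfl⟩ :=
        hβ.exists_index (Finset.mem_Icc.1 hj).1 (Finset.mem_Icc.1 hj).2
      rw [inn_smul_left, hβ.inn_aa hik]
      simp only [h, Equiv.symm_apply_apply, hik]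
      push_cast
      have : (0 : ℝ) ≤ c (((i : ℕ) + 1) * p % n) := by positivity
      linarith
    rw [h1] at h2
    have h3 : (i : ℕ) ≤ k := by
      have : ((i : ℕ) : ℝ) ≤ (k : ℕ) := by linarith
      exact_mod_cast this
    exact lt_of_le_of_ne (Fin.le_def.2 h3) hne
  · intro hik
    refine ⟨⟨β i + 1, by rw [Finset.mem_Icc]; omega, β k + 1, by rw [Finset.mem_Icc]; omega,
      fun h => hik.ne (β.injective (Fin.ext (by omega))), rfl⟩, ?_⟩
    have key : ∀ (m : ℕ) (k : Fin n), (k : ℕ) = i + m → ∃ c : ℕ → ℕ,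
        (Pi.single (β i) 1 - Pi.single (β k) 1 : Fin n → ℝ) =
          ∑ j ∈ Icc 1 (n - 1), (c j : ℝ) • aa n p j := by
      intro m
      induction m with
      | zero =>
        intro k hk
        refine ⟨0, ?_⟩
        rw [show k = i from Fin.ext hk]
        simp
      | succ m ih =>
        intro k hk
        have hl : (i : ℕ) + m < n := by omega
        obtain ⟨c, hc⟩ := ih ⟨i + m, hl⟩ rfl
        refine ⟨c + Pi.single ((i + m + 1) * p % n) 1, ?_⟩
        have hj := Finset.mem_Icc.2 (chain_index_bounds (n := n) hcop (i := i + m) (by omega))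
        simp only [Pi.add_apply, Nat.cast_add, add_smul, Finset.sum_add_distrib, ← hc]
        rw [Finset.sum_eq_single_of_mem _ hj (fun b _ hb => by simp [hb]), Pi.single_eq_same]
        have := hβ.aa_eq (i := ⟨i + m, hl⟩) (k := k) (by simp [hk]; omega)
        simp only at this
        rw [this]
        simp
    rw [ee_succ, ee_succ]
    exact key (k - i) k (by have := Fin.lt_def.1 hik; omega)

lemma sin_add_period {α : ℝ} (hα : α ≠ 0) (y : ℝ) (w : ℤ) :
    Real.sin (α * (y + 2 * π / α * w) / 2) = (-1) ^ w * Real.sin (α * y / 2) := by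
  rw [← Real.sin_add_int_mul_pi]
  congr 1
  field_simp

lemma sin_div_sin_add_period {α : ℝ} (hα : α ≠ 0) (y z : ℝ) (w : ℤ) :
    Real.sin (α * (y + 2 * π / α * w) / 2) / Real.sin (α * (z + 2 * π / α * w) / 2) =
      Real.sin (α * y / 2) / Real.sin (α * z / 2) := by
  rw [sin_add_period hα, sin_add_period hα, mul_div_mul_left]
  exact zpow_ne_zero _ (by norm_num)

lemma vfac_add_period {α : ℝ} (hα : α ≠ 0) (g D : ℝ) (w : ℤ) :
    vfac α g (D + 2 * π / α * w) = vfac α g D := by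
  unfold vfac
  rw [add_right_comm, sin_div_sin_add_period hα]

lemma poch_natCast (α z : ℝ) (C : ℕ) :
    poch α z C = ∏ l ∈ range C, Real.sin (α * (z + l) / 2) := by
  simp [poch]

lemma poch_neg_natCast (α z : ℝ) (C : ℕ) :
    poch α z (-C) = (∏ l ∈ range C, Real.sin (α * (z - (l + 1)) / 2))⁻¹ := by
  rcases Nat.eq_zero_or_pos C with rfl | hC
  · simp [poch]
  · rw [poch, if_neg (by omega), neg_neg, Int.toNat_natCast, one_div, prod_Icc_one,
      ← Fin.prod_univ_eq_prod_range (fun l => Real.sin (α * (z - (l + 1)) / 2))]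
    push_cast
    rfl

lemma poch_div_poch {s : ℝ} (hs : s = 1 ∨ s = -1) (α g z : ℝ) (C : ℕ) :
    poch α (z + s * g) ⌊s * C⌋ / poch α (z + 1 - s * g) ⌊s * C⌋ =
      ∏ l ∈ range C, Real.sin (α * (z + g + s * l) / 2) /
        Real.sin (α * (z - g + s * (l + 1)) / 2) := by
  rcases hs with rfl | rfl
  · simp only [one_mul, Int.floor_natCast]
    rw [poch_natCast, poch_natCast, ← Finset.prod_div_distrib]
    refine Finset.prod_congr rfl fun l _ => ?_
    congr 3
    ring
  · have h : ⌊(-1 : ℝ) * C⌋ = -(C : ℤ) := by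
      rw [neg_one_mul, ← Int.cast_natCast, ← Int.cast_neg, Int.floor_intCast]
    rw [h, poch_neg_natCast, poch_neg_natCast, ← Finset.prod_inv_distrib,
      ← Finset.prod_inv_distrib, ← Finset.prod_div_distrib]
    refine Finset.prod_congr rfl fun l _ => ?_
    rw [inv_div_inv]
    congr 3 <;> ring

lemma IsDualBasis.Delta_eq {n p : ℕ} {ω : ℕ → Fin n → ℝ} (hω : IsDualBasis n p ω)
    {β : Equiv.Perm (Fin n)} (hβ : IsChainOrder n p β) (hcop : Nat.Coprime p n)
    (hp1 : 1 ≤ p) {α g s : ℝ} (hα : α ≠ 0) (hs : s = 1 ∨ s = -1)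
    (hsM : Real.sign (2 * π * p / α - n * g) = s) {S : Fin n → ℤ} {μ : Fin n → ℝ}
    (hS : Monotone S) (hμ : IsChainLift β μ S) :
    Delta n p α g ω μ = chainDelta α g s S := by
  unfold Delta chainDelta
  rw [prod_Icc_one, ← Equiv.prod_comp β]
  refine Finset.prod_congr rfl fun i _ => ?_
  rw [prod_Icc_one, ← Equiv.prod_comp β]
  refine Finset.prod_congr rfl fun k _ => ?_
  simp only [hβ.inPosRoots_iff hcop, inn_add_right, inn_smul_right, inn_ee_sub, hsM]
  split_ifs with hik
  · obtain ⟨w, hw⟩ := hω.rhoP_sub hβ hcop hp1 α g i k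
    have hC : ((S k : ℝ) - S i) = ((S k - S i).toNat : ℝ) := by
      rw [← Int.cast_natCast, Int.toNat_of_nonneg (sub_nonneg.2 (hS hik.le)), Int.cast_sub]
    have hd : (((k : ℕ) - (i : ℕ) : ℕ) : ℝ) = ((k : ℕ) : ℝ) - (i : ℕ) :=
      Nat.cast_sub (Fin.lt_def.1 hik).le
    rw [hμ i k, hC, hw, poch_div_poch hs]
    unfold chainPhi
    rw [hd]
    congr 1
    · rw [add_right_comm, sin_div_sin_add_period hα]
    · refine Finset.prod_congr rfl fun l _ => ?_
      refine Eq.trans ?_ (sin_div_sin_add_period hα _ _ w)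
      congr 3 <;> ring
  · rfl

lemma Vnu_subsetWeight_chain {n r : ℕ} {α : ℝ} (hα : α ≠ 0) (g : ℝ) (β : Equiv.Perm (Fin n))
    (J : Finset (Fin n)) (x : Fin n → ℝ) (D : Fin n → Fin n → ℝ)
    (hD : ∀ i k, ∃ w : ℤ, x (β i) - x (β k) = D i k + 2 * π / α * w) :
    Vnu n α g (subsetWeight r J) x = ∏ i, ∏ k,
      if i ∈ univ.filter (fun i => β i ∈ J) ∧ k ∉ univ.filter (fun i => β i ∈ J) then
        vfac α g (D i k) else 1 := by
  rw [Vnu_subsetWeight, ← Equiv.prod_comp β]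
  refine Finset.prod_congr rfl fun i _ => ?_
  rw [← Equiv.prod_comp β]
  refine Finset.prod_congr rfl fun k _ => ?_
  simp only [Finset.mem_filter, Finset.mem_univ, true_and]
  obtain ⟨w, hw⟩ := hD i k
  rw [hw, vfac_add_period hα]

/-- The centre of the simplex `Σ_{g,p}`. -/
def simplexCenter (n : ℕ) (α : ℝ) : Fin n → ℝ :=
  fun a => 2 * π / α / n * (((n : ℝ) - 1) / 2 - (a : ℕ))

lemma simplexCenter_mem {n p : ℕ} {α g : ℝ} (hn : 0 < n)
    (hM : 2 * π * p / α - n * g ≠ 0) : simplexCenter n α ∈ SigmaInt n p α g := by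
  have hn' : (n : ℝ) ≠ 0 := by exact_mod_cast hn.ne'
  have hcoord : ∀ j : ℕ, 1 ≤ j → coord α (simplexCenter n α) j =
      2 * π / α / n * (((n : ℝ) - 1) / 2 - (j - 1)) := by
    intro j hj
    have h1 : ((n * ((j - 1) / n) + (j - 1) % n : ℕ) : ℝ) = ((j - 1 : ℕ) : ℝ) := by
      rw [Nat.div_add_mod]
    push_cast [hj] at h1
    rw [coord, dif_pos hn, simplexCenter, ← h1]
    field_simp
    ring
  refine ⟨?_, fun j hj => ?_⟩
  · unfold simplexCenter
    rw [← Finset.mul_sum, Finset.sum_sub_distrib, Fin.sum_univ_eq_sum_range (fun i => (i : ℝ)),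
      ← Nat.cast_sum]
    have h2 : ((∑ i ∈ range n, i : ℕ) : ℝ) * 2 = n * ((n - 1 : ℕ) : ℝ) := by
      exact_mod_cast Finset.sum_range_id_mul_two n
    push_cast [Nat.cast_sub (show 1 ≤ n from hn)] at h2
    rw [Finset.sum_const, Finset.card_univ, Fintype.card_fin, nsmul_eq_mul]
    push_cast
    rw [show (n : ℝ) * (((n : ℝ) - 1) / 2) - ∑ x ∈ range n, (x : ℝ) = 0 by linarith, mul_zero]
  · have hj1 := (Finset.mem_Icc.1 hj).1
    rw [hcoord j hj1, hcoord (j + p) (by omega)]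
    have h : 2 * π / α / n * (((n : ℝ) - 1) / 2 - (j - 1)) -
        2 * π / α / n * (((n : ℝ) - 1) / 2 - (((j + p : ℕ) : ℝ) - 1)) - g =
        (2 * π * p / α - n * g) / n := by
      push_cast
      field_simp
      ring
    rw [h, ← mul_div_assoc]
    refine div_pos ?_ (by positivity)
    rw [mul_comm]
    rcases lt_or_gt_of_ne hM with h | h
    · rw [Real.sign_of_neg h]; linarith
    · rw [Real.sign_of_pos h]; linarith

lemma simplexCenter_sub {n p K : ℕ} {α g s : ℝ} (hn : 0 < n)
    {β : Equiv.Perm (Fin n)} (hβ : IsChainOrder n p β)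
    (hM : n * g + s * K = p * (2 * π / α)) (i k : Fin n) :
    ∃ w : ℤ, simplexCenter n α (β i) - simplexCenter n α (β k) =
      chainDiff g s (fun j => ((j : ℕ) : ℝ) * K / n) i k + 2 * π / α * w := by
  have hn' : (n : ℝ) ≠ 0 := by exact_mod_cast hn.ne'
  have hmod : ∀ i : Fin n, ∃ w : ℤ, (((β i : ℕ) : ℤ) + 1) = ((i : ℕ) + 1) * p + n * w := by
    intro i
    have h1 : (((i : ℕ) + 1) * p) ≡ ((β i : ℕ) + 1) [MOD n] := (hβ i).symm
    obtain ⟨w, hw⟩ := (Nat.modEq_iff_dvd.1 h1)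
    push_cast at hw
    exact ⟨w, by linarith⟩
  obtain ⟨u, hu⟩ := hmod i
  obtain ⟨v, hv⟩ := hmod k
  have hu' : ((β i : ℕ) : ℝ) + 1 = ((i : ℕ) + 1) * p + n * u := by exact_mod_cast hu
  have hv' : ((β k : ℕ) : ℝ) + 1 = ((k : ℕ) + 1) * p + n * v := by exact_mod_cast hv
  refine ⟨v - u, ?_⟩
  unfold simplexCenter chainDiff
  rw [show ((β i : ℕ) : ℝ) = ((i : ℕ) + 1) * p + n * u - 1 by linarith,
    show ((β k : ℕ) : ℝ) = ((k : ℕ) + 1) * p + n * v - 1 by linarith]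
  have hg : g = (p * (2 * π / α) - s * K) / n := by
    rw [← hM]; field_simp; ring
  rw [hg]
  push_cast
  generalize 2 * π / α = T
  field_simp
  ring

lemma IsChainLift.unique {n : ℕ} {β : Equiv.Perm (Fin n)} {μ : Fin n → ℝ} {S S' : Fin n → ℤ}
    (h : IsChainLift β μ S) (h' : IsChainLift β μ S') (i k : Fin n) :
    S k - S i = S' k - S' i := by
  have := (h i k).symm.trans (h' i k)
  exact_mod_cast this

lemma ChainValid.congr {n K : ℕ} {S S' : Fin n → ℤ} (hS : ChainValid n K S)
    (h : ∀ i k, S k - S i = S' k - S' i) : ChainValid n K S' :=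
  ⟨fun i k hik => by have := hS.1 i k hik; have := h i k; omega,
    fun i k hi hk => by have := hS.2 i k hi hk; have := h i k; omega⟩

lemma isChainLift_add_subsetWeight {n r : ℕ} {β : Equiv.Perm (Fin n)} {μ : Fin n → ℝ}
    {S : Fin n → ℤ} (h : IsChainLift β μ S) (J : Finset (Fin n)) :
    IsChainLift β (μ + subsetWeight r J)
      (fun i => S i - if i ∈ univ.filter (fun i => β i ∈ J) then 1 else 0) := by
  intro i k
  have := h i k
  simp only [Pi.add_apply, subsetWeight, Finset.mem_filter, Finset.mem_univ, true_and]
  push_cast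
  linear_combination this

lemma TypeI.lt_period {n p q : ℕ} {α g : ℝ} (hα : 0 < α) (h : TypeI n p q α g) :
    (0 < 2 * π * p / α - n * g → q * (2 * π * p / α - n * g) < 2 * π / α) ∧
    (2 * π * p / α - n * g < 0 →
      ((n : ℝ) - q) * (-(2 * π * p / α - n * g)) < 2 * π / α) := by
  obtain ⟨hq1, hqn, -, hg⟩ := h
  have hq0 : (0 : ℝ) < q := by exact_mod_cast hq1
  have hn0 : (0 : ℝ) < n := by exact_mod_cast (show 0 < n by omega)
  have hnq : (0 : ℝ) < (n : ℝ) - q := by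
    rw [sub_pos]; exact_mod_cast (show q < n by omega)
  have hp : 2 * π * p / α = n * (2 * π / α * (p / n)) := by field_simp
  have hT : 0 < 2 * π / α := by positivity
  rw [hp]
  generalize 2 * π / α = T at *
  refine ⟨fun h => ?_, fun h => ?_⟩
  · rcases hg with hg | hg
    · have h1 : n * q * (T * ((p : ℝ) / n - 1 / ((n : ℝ) * q))) =
          q * (n * (T * (p / n))) - T := by field_simp
      have h2 := mul_lt_mul_of_pos_left hg.1 (mul_pos hn0 hq0)
      nlinarith
    · nlinarith [mul_lt_mul_of_pos_left hg.1 hn0]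
  · rcases hg with hg | hg
    · nlinarith [mul_lt_mul_of_pos_left hg.2 hn0]
    · have h1 : n * ((n : ℝ) - q) * (T * ((p : ℝ) / n + 1 / ((n : ℝ) * ((n : ℝ) - q)))) =
          ((n : ℝ) - q) * (n * (T * (p / n))) + T := by field_simp
      have h2 := mul_lt_mul_of_pos_left hg.2 (mul_pos hn0 hnq)
      nlinarith

lemma prod_vfac_sign {n K p : ℕ} {α g s : ℝ} (hα : 0 < α) (h : SameSign n K α g s)
    (hM : n * g + s * K = p * (2 * π / α)) {S R : Fin n → ℝ}
    (hS : ∀ i k, i ≤ k → 0 ≤ S k - S i ∧ S k - S i ≤ K)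
    (hR : ∀ i k, i < k → 0 < R k - R i ∧ R k - R i < K) (J : Finset (Fin n)) :
    0 ≤ (∏ i, ∏ k, if i ∈ J ∧ k ∉ J then vfac α g (chainDiff g s S i k) else 1) *
        (∏ i, ∏ k, if i ∈ J ∧ k ∉ J then vfac α g (chainDiff g s R i k) else 1) ∧
      (∏ i, ∏ k, if i ∈ J ∧ k ∉ J then vfac α g (chainDiff g s R i k) else 1) ≠ 0 := by
  constructor
  · rw [← Finset.prod_mul_distrib]
    refine Finset.prod_nonneg fun i _ => ?_
    rw [← Finset.prod_mul_distrib]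
    refine Finset.prod_nonneg fun k _ => ?_
    split_ifs with hik
    · exact (vfac_chainDiff_sign hα h hM hS hR (by rintro rfl; exact hik.2 hik.1)).1
    · norm_num
  · refine Finset.prod_ne_zero_iff.2 fun i _ => Finset.prod_ne_zero_iff.2 fun k _ => ?_
    split_ifs with hik
    · exact (vfac_chainDiff_sign hα h hM hS hR (by rintro rfl; exact hik.2 hik.1)).2
    · norm_num

lemma sign_mul_abs_of_mul_nonneg {a b : ℝ} (h : 0 ≤ a * b) (hb : b ≠ 0) :
    Real.sign b * |a| = a := by
  rcases lt_or_gt_of_ne hb with hb | hb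
  · have : a ≤ 0 := by by_contra! ha; nlinarith
    rw [Real.sign_of_neg hb, abs_of_nonpos this]; ring
  · have : 0 ≤ a := by by_contra! ha; nlinarith
    rw [Real.sign_of_pos hb, abs_of_nonneg this]; ring

lemma ChainValid.sub_bounds {n K : ℕ} {S : Fin n → ℤ} (hS : ChainValid n K S) (i k : Fin n)
    (hik : i ≤ k) : 0 ≤ (S k : ℝ) - S i ∧ (S k : ℝ) - S i ≤ K := by
  constructor
  · exact_mod_cast sub_nonneg.2 (hS.monotone hik)
  · exact_mod_cast hS.sub_le i k

lemma IsDualBasis.rhoP_add_sub {n p : ℕ} {ω : ℕ → Fin n → ℝ} (hω : IsDualBasis n p ω)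
    {β : Equiv.Perm (Fin n)} (hβ : IsChainOrder n p β) (hcop : Nat.Coprime p n)
    (hp1 : 1 ≤ p) (α g s : ℝ) {μ : Fin n → ℝ} {S : Fin n → ℤ} (hμ : IsChainLift β μ S)
    (i k : Fin n) :
    ∃ w : ℤ, (rhoP n p α g ω + s • μ) (β i) - (rhoP n p α g ω + s • μ) (β k) =
      chainDiff g s (fun j => (S j : ℝ)) i k + 2 * π / α * w := by
  obtain ⟨w, hw⟩ := hω.rhoP_sub hβ hcop hp1 α g i k
  refine ⟨w, ?_⟩
  simp only [Pi.add_apply, Pi.smul_apply, smul_eq_mul, chainDiff]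
  linear_combination hw + s * hμ i k

lemma IsDualBasis.ground_state_term {n p r K : ℕ} {ω : ℕ → Fin n → ℝ}
    (hω : IsDualBasis n p ω) {β : Equiv.Perm (Fin n)} (hβ : IsChainOrder n p β)
    (hcop : Nat.Coprime p n) (hp1 : 1 ≤ p) {α g s : ℝ} (hα : 0 < α) (hs : s = 1 ∨ s = -1)
    (hsM : Real.sign (2 * π * p / α - n * g) = s) (hKM : |2 * π * p / α - n * g| = K)
    (hM : n * g + s * K = p * (2 * π / α)) (h : SameSign n K α g s) (hn : 0 < n) (hK : 0 < K)
    {J : Finset (Fin n)} (hJ : J ∈ powersetCard r (univ : Finset (Fin n)))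
    {σ : (Fin n → ℝ) → ℝ}
    (hσ : σ (subsetWeight r J) =
      Real.sign (Vnu n α g (subsetWeight r J) (simplexCenter n α)))
    {μ : Fin n → ℝ} (hsum : ∑ i, μ i = 0) {S : Fin n → ℤ} (hS : ChainValid n K S)
    (hμ : IsChainLift β μ S) :
    (if μ + subsetWeight r J ∈ Lam n |2 * π * p / α - n * g| ω then
        Wmu n p α g ω σ μ (subsetWeight r J) *
          Real.sqrt (Delta n p α g ω (μ + subsetWeight r J))
      else 0) =
      Vnu n α g (subsetWeight r J) (rhoP n p α g ω + s • μ) *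
        Real.sqrt (Delta n p α g ω μ) := by
  set I := univ.filter (fun i => β i ∈ J) with hI
  set S' : Fin n → ℤ := fun i => S i - if i ∈ I then 1 else 0 with hS'
  have hν : IsChainLift β (μ + subsetWeight r J) S' := isChainLift_add_subsetWeight hμ J
  have hV := Vnu_subsetWeight_chain (r := r) hα.ne' g β J _ _
    (hω.rhoP_add_sub hβ hcop hp1 α g s hμ)
  have hmem : μ + subsetWeight r J ∈ Lam n |2 * π * p / α - n * g| ω ↔ ChainValid n K S' := by
    rw [hKM, hω.mem_Lam_iff hβ hcop hn]
    constructor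
    · rintro ⟨-, R, hR, hR'⟩
      exact hR.congr (hR'.unique hν)
    · refine fun hv => ⟨?_, S', hv, hν⟩
      simp only [Pi.add_apply, Finset.sum_add_distrib, hsum, sum_subsetWeight hn hJ, add_zero]
  by_cases hv : ChainValid n K S'
  swap
  · rw [if_neg (mt hmem.1 hv), hV, prod_vfac_eq_zero hα hM I hS hv fun _ => rfl, zero_mul]
  have hV0 := Vnu_subsetWeight_chain (r := r) hα.ne' g β J _ _ (simplexCenter_sub hn hβ hM)
  have hV' := Vnu_subsetWeight_chain (r := r) hα.ne' g β J
    (-(rhoP n p α g ω) - s • (μ + subsetWeight r J))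
    (fun i k => if i ∈ I ∧ k ∉ I then -(chainDiff g s (fun j => (S j : ℝ)) i k + s)
      else -(chainDiff g s (fun j => (S' j : ℝ)) i k)) (by
    intro i k
    obtain ⟨w, hw⟩ := hω.rhoP_add_sub hβ hcop hp1 α g s hν i k
    refine ⟨-w, ?_⟩
    have h1 : chainDiff g s (fun j => (S' j : ℝ)) i k =
        chainDiff g s (fun j => (S j : ℝ)) i k +
          s * ((if i ∈ I then 1 else 0) - if k ∈ I then 1 else 0) := by
      simp only [chainDiff, hS']
      push_cast
      ring
    have h2 : (if i ∈ I ∧ k ∉ I then -(chainDiff g s (fun j => (S j : ℝ)) i k + s)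
      else -(chainDiff g s (fun j => (S' j : ℝ)) i k)) =
        -(chainDiff g s (fun j => (S' j : ℝ)) i k) := by
      split_ifs with hik
      · rw [h1, if_pos hik.1, if_neg hik.2]; ring
      · rfl
    rw [h2]
    simp only [Pi.add_apply, Pi.sub_apply, Pi.neg_apply, Pi.smul_apply, smul_eq_mul] at hw ⊢
    push_cast
    linear_combination -hw)
  have hV'' : Vnu n α g (subsetWeight r J) (-(rhoP n p α g ω) - s • (μ + subsetWeight r J)) =
      ∏ i, ∏ k, if i ∈ I ∧ k ∉ I then
        vfac α g (-(chainDiff g s (fun j => (S j : ℝ)) i k + s)) else 1 := by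
    rw [hV']
    refine Finset.prod_congr rfl fun i _ => Finset.prod_congr rfl fun k _ => ?_
    split_ifs <;> rfl
  have hbal := chainDelta_balance h I hS hv fun _ => rfl
  have hsign := prod_vfac_sign hα h hM (fun i k => hS.sub_bounds i k)
    (R := fun j => ((j : ℕ) : ℝ) * K / n) (by
      intro i k hik
      have hn' : (0 : ℝ) < n := by exact_mod_cast hn
      have hK' : (0 : ℝ) < K := by exact_mod_cast hK
      have h1 : ((i : ℕ) : ℝ) < (k : ℕ) := by exact_mod_cast hik
      have h2 : ((k : ℕ) : ℝ) - (i : ℕ) < n := by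
        have h3 : ((k : ℕ) : ℝ) < n := by exact_mod_cast k.2
        have h4 : (0 : ℝ) ≤ (i : ℕ) := by positivity
        linarith
      rw [← sub_div, ← sub_mul]
      refine ⟨div_pos (mul_pos (by linarith) hK') hn', ?_⟩
      rw [div_lt_iff₀ hn']
      nlinarith) I
  rw [← hV, ← hV0] at hsign
  rw [← hV, ← hV''] at hbal
  have hD := hω.Delta_eq hβ hcop hp1 hα.ne' hs hsM hS.monotone hμ
  have hD' := hω.Delta_eq hβ hcop hp1 hα.ne' hs hsM hv.monotone hν
  have hpos' := chainDelta_pos hα hK h hM hv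
  rw [if_pos (hmem.2 hv), Wmu, if_pos (hmem.2 hv), hsM, hD, hD', hσ, mul_assoc,
    ← Real.sqrt_mul' _ hpos'.le]
  set V := Vnu n α g (subsetWeight r J) (rhoP n p α g ω + s • μ)
  rw [show ∀ V' : ℝ, V * V' * chainDelta α g s S' = V * (chainDelta α g s S' * V') from
    fun _ => by ring, hbal, show V * (chainDelta α g s S * V) = V ^ 2 * chainDelta α g s S by ring,
    Real.sqrt_mul (sq_nonneg V), Real.sqrt_sq_eq_abs, ← mul_assoc,
    sign_mul_abs_of_mul_nonneg hsign.1 hsign.2]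

lemma IsDualBasis.sin_rhoP_add_ne_zero {n p K : ℕ} {ω : ℕ → Fin n → ℝ}
    (hω : IsDualBasis n p ω) {β : Equiv.Perm (Fin n)} (hβ : IsChainOrder n p β)
    (hcop : Nat.Coprime p n) (hp1 : 1 ≤ p) {α g s : ℝ} (hα : 0 < α)
    (h : SameSign n K α g s) {μ : Fin n → ℝ} {S : Fin n → ℤ} (hS : ChainValid n K S)
    (hμ : IsChainLift β μ S) {i k : Fin n} (hik : i ≠ k) :
    Real.sin (α * ((rhoP n p α g ω + s • μ) i - (rhoP n p α g ω + s • μ) k) / 2) ≠ 0 := by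
  have key : ∀ i k : Fin n, i < k → Real.sin (α * ((rhoP n p α g ω + s • μ) (β i) -
      (rhoP n p α g ω + s • μ) (β k)) / 2) ≠ 0 := by
    intro i k hik
    have hik' := Fin.lt_def.1 hik
    obtain ⟨w, hw⟩ := hω.rhoP_add_sub hβ hcop hp1 α g s hμ i k
    have hb := hS.sub_bounds i k hik.le
    have h1 := h.ne_zero (d := (k : ℕ) - i) (by omega) hb.1 hb.2 (by omega) (by omega)
    rw [Nat.cast_sub hik'.le] at h1
    rw [hw, sin_add_period hα.ne']
    exact mul_ne_zero (zpow_ne_zero _ (by norm_num)) h1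
  obtain ⟨i, rfl⟩ := β.surjective i
  obtain ⟨k, rfl⟩ := β.surjective k
  rcases lt_or_gt_of_ne (fun e => hik (congrArg β e) : i ≠ k) with hlt | hlt
  · exact key i k hlt
  · have := key k i hlt
    rw [← neg_sub, mul_neg, neg_div, Real.sin_neg]
    exact neg_ne_zero.2 this

/-- Proposition 3.4: the ground state property
`Σ_{ν : μ+ν∈Λ⁺} W_ν(ρ_p+sgn(M)μ)·√Δ_p(μ+ν) = ℰ_r(ρ(g))·√Δ_p(μ)`,
where `ρ(g) = g(ω_1+…+ω_{n-1})`. -/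
theorem statement17 (n p q : ℕ) (α g : ℝ)
    (hn : 2 ≤ n) (hα : 0 < α) (hp1 : 1 ≤ p) (hpn : p ≤ n - 1) (hcop : Nat.Coprime p n)
    (htype : TypeI n p q α g)
    (Mz : ℤ) (hMz : 2 * π * p / α - n * g = (Mz : ℝ)) (hMz0 : Mz ≠ 0)
    (ω : ℕ → Fin n → ℝ)
    (hωE : ∀ k : ℕ, 1 ≤ k → k ≤ n - 1 → ∑ i, ω k i = 0)
    (hωδ : ∀ j : ℕ, 1 ≤ j → j ≤ n - 1 → ∀ k : ℕ, 1 ≤ k → k ≤ n - 1 →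
      inn (aa n p j) (ω k) = if j = k then (1 : ℝ) else 0)
    (s : (Fin n → ℝ) → ℝ)
    (hs : ∀ r : ℕ, 1 ≤ r → r ≤ n - 1 → ∀ ν : Fin n → ℝ, inOrbit n r ν →
      ∀ x ∈ SigmaInt n p α g, s ν = Real.sign (Vnu n α g ν x))
    (r : ℕ) (hr1 : 1 ≤ r) (hrn : r ≤ n - 1)
    (μ : Fin n → ℝ) (hμ : μ ∈ Lam n |2 * π * p / α - n * g| ω) :
    ((∑ ν ∈ orbitF n r,
        if μ + ν ∈ Lam n |2 * π * p / α - n * g| ω then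
          Wmu n p α g ω s μ ν * Real.sqrt (Delta n p α g ω (μ + ν))
        else 0 : ℝ) : ℂ) =
      calE n r α (g • ∑ k ∈ Icc 1 (n - 1), omegaStd n k) *
        ((Real.sqrt (Delta n p α g ω μ) : ℝ) : ℂ) := by
  have hn0 : 0 < n := by omega
  have hω : IsDualBasis n p ω := ⟨hωE, hωδ⟩
  obtain ⟨β, hβ⟩ := exists_isChainOrder hn0 hcop
  have hq := htype.lt_period hα
  obtain ⟨hq1, hqn, hpq, -⟩ := htype
  set M := 2 * π * p / α - n * g with hMdef
  have hM0 : M ≠ 0 := by rw [hMz]; exact_mod_cast hMz0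
  set K := Mz.natAbs with hKdef
  have hK : 0 < K := Int.natAbs_pos.2 hMz0
  have hKM : |M| = K := by rw [hMz, hKdef, Nat.cast_natAbs, Int.cast_abs]
  obtain ⟨e, heM, hMe, he⟩ : ∃ e : ℝ, Real.sign M = e ∧ M = e * K ∧
      ((e = 1 ∧ q * K < 2 * π / α) ∨ (e = -1 ∧ ((n : ℝ) - q) * K < 2 * π / α)) := by
    rcases lt_or_gt_of_ne hM0 with h | h
    · rw [abs_of_neg h] at hKM
      exact ⟨-1, Real.sign_of_neg h, by rw [← hKM]; ring, Or.inr ⟨rfl, by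
        rw [← hKM]; exact hq.2 h⟩⟩
    · rw [abs_of_pos h] at hKM
      exact ⟨1, Real.sign_of_pos h, by rw [← hKM]; ring, Or.inl ⟨rfl, by
        rw [← hKM]; exact hq.1 h⟩⟩
  have he1 : e = 1 ∨ e = -1 := he.imp And.left And.left
  have hM : n * g + e * K = p * (2 * π / α) := by rw [← hMe, hMdef]; ring
  have hsame : SameSign n K α g e := sameSign_of_bound hα hpq hq1 (by omega) hM he
  obtain ⟨hsum, S, hS, hμS⟩ := (hω.mem_Lam_iff hβ hcop hn0).1 (hKM ▸ hμ)
  rw [sum_orbitF (by omega), Finset.sum_congr rfl fun J hJ =>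
    hω.ground_state_term hβ hcop hp1 hα he1 heM hKM hM hsame hn0 hK hJ
      (hs r hr1 hrn _ (inOrbit_subsetWeight (by omega) hJ) _ (simplexCenter_mem hn0 hM0))
      hsum hS hμS, ← Finset.sum_mul, Complex.ofReal_mul, calE_eq hn0 (by omega),
    ← sum_prod_sin_ratio α g (rhoP n p α g ω + e • μ) fun i k hik =>
      hω.sin_rhoP_add_ne_zero hβ hcop hp1 hα hsame hS hμS hik]
  simp only [Vnu_subsetWeight, vfac]
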